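/- Let (X_t)_{t∈ℝ^d} be a centered stationary Gaussian field with continuous sample paths, E[X_t²] = 1, and covariance Cov(X_s, X_t) = φ(|t−s|) where |·| is the Euclidean norm and φ : [0,∞) → ℝ is non-increasing with φ(1) < 1/2. For a bounded subset A of ℝ^d let N(A) be the minimal number of Euclidean balls of radius 1 needed to cover A, and set M_A = sup_{s∈A} X_s. Then there exist constants C = C(φ,d) > 0 and c = c(φ,d) > 0, depending only on φ and d, such that for every bounded A ⊂ ℝ^d with N(A) > 1 and all t ≥ 0, P(|M_A − E[M_A]| ≥ t) ≤ 6 e^{−c t/√(K_{N(A)})}, where K_{N(A)} = max(φ(N(A)^C), 1/log N(A)). -/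

import Mathlib

open MeasureTheory ProbabilityTheory Real

/-- The covering number `N(A) = N(A,1)`: the minimal number of (closed) Euclidean balls of
radius `1` needed to cover `A`. -/
noncomputable def coveringNumber {d : ℕ} (A : Set (EuclideanSpace ℝ (Fin d))) : ℕ :=
  sInf {k : ℕ | ∃ c : Fin k → EuclideanSpace ℝ (Fin d),
    A ⊆ ⋃ i, Metric.closedBall (c i) 1}

open scoped ENNReal NNReal
set_option linter.unusedSectionVars false
set_option linter.style.haveILetI false


lemma tp_k (s a : ℝ) (hs0 : 0 ≤ s) (hs1 : s ≤ 1) (ha0 : 0 ≤ a) (ha1 : a ≤ 1) :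
    2 * s * a ≤ (1 + a) ^ s - (1 - a) ^ s := by
  have hmono : MonotoneOn (fun a : ℝ => (1 + a) ^ s - (1 - a) ^ s - 2 * s * a) (Set.Icc 0 1) := by
    apply monotoneOn_of_deriv_nonneg (convex_Icc 0 1)
    · apply ContinuousOn.sub
      · apply ContinuousOn.sub
        · exact ContinuousOn.rpow_const (by fun_prop) (fun x hx => Or.inr hs0)
        · exact ContinuousOn.rpow_const (by fun_prop) (fun x hx => Or.inr hs0)
      · fun_prop
    · intro x hx
      rw [interior_Icc] at hx
      have h1 : (1 + x) ≠ 0 := by linarith [hx.1]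
      have h2 : (1 - x) ≠ 0 := by linarith [hx.2]
      apply DifferentiableAt.differentiableWithinAt
      have e1 : DifferentiableAt ℝ (fun x : ℝ => (1 + x) ^ s) x :=
        DifferentiableAt.rpow_const (by fun_prop) (Or.inl h1)
      have e2 : DifferentiableAt ℝ (fun x : ℝ => (1 - x) ^ s) x :=
        DifferentiableAt.rpow_const (by fun_prop) (Or.inl h2)
      exact (e1.sub e2).sub (by fun_prop)
    · intro x hx
      rw [interior_Icc] at hx
      have h1 : 0 < (1 + x) := by linarith [hx.1]
      have h2 : 0 < (1 - x) := by linarith [hx.2]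
      have d1 : HasDerivAt (fun x : ℝ => (1 + x) ^ s) (1 * s * (1 + x) ^ (s - 1)) x :=
        HasDerivAt.rpow_const ((hasDerivAt_id x).const_add 1) (Or.inl h1.ne')
      have d2 : HasDerivAt (fun x : ℝ => (1 - x) ^ s) (-1 * s * (1 - x) ^ (s - 1)) x :=
        HasDerivAt.rpow_const ((hasDerivAt_id x).const_sub 1) (Or.inl h2.ne')
      have d3 : HasDerivAt (fun x : ℝ => 2 * s * x) (2 * s * 1) x :=
        (hasDerivAt_id x).const_mul _
      have e : deriv (fun a : ℝ => (1 + a) ^ s - (1 - a) ^ s - 2 * s * a) x = _ :=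
        ((d1.sub d2).sub d3).deriv
      rw [e]
      have key : 2 ≤ (1 + x) ^ (s - 1) + (1 - x) ^ (s - 1) := by
        set A := (1 + x) ^ (s - 1)
        set B := (1 - x) ^ (s - 1)
        have hA : 0 < A := rpow_pos_of_pos h1 _
        have hB : 0 < B := rpow_pos_of_pos h2 _
        have hAB : 1 ≤ A * B := by
          rw [← mul_rpow h1.le h2.le]
          apply one_le_rpow_of_pos_of_le_one_of_nonpos
          · positivity
          · nlinarith [hx.1]
          · linarith
        nlinarith [sq_nonneg (A - B)]
      nlinarith
  have := hmono (Set.left_mem_Icc.2 zero_le_one) ⟨ha0, ha1⟩ ha0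
  simp at this
  linarith

lemma tp_g (p a : ℝ) (hp1 : 1 ≤ p) (hp2 : p ≤ 2) (ha0 : 0 ≤ a) (ha1 : a ≤ 1) :
    1 + p * (p - 1) / 2 * a ^ 2 ≤ ((1 + a) ^ p + (1 - a) ^ p) / 2 := by
  have hmono : MonotoneOn (fun a : ℝ => ((1 + a) ^ p + (1 - a) ^ p) / 2
      - p * (p - 1) / 2 * a ^ 2) (Set.Icc 0 1) := by
    apply monotoneOn_of_deriv_nonneg (convex_Icc 0 1)
    · apply ContinuousOn.sub
      · apply ContinuousOn.div_const
        apply ContinuousOn.add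
        · exact ContinuousOn.rpow_const (by fun_prop) (fun x hx => Or.inr (by linarith))
        · exact ContinuousOn.rpow_const (by fun_prop) (fun x hx => Or.inr (by linarith))
      · fun_prop
    all_goals
      intro x hx
      rw [interior_Icc] at hx
      have h1 : 0 < (1 + x) := by linarith [hx.1]
      have h2 : 0 < (1 - x) := by linarith [hx.2]
      have d1 : HasDerivAt (fun x : ℝ => (1 + x) ^ p) (1 * p * (1 + x) ^ (p - 1)) x :=
        HasDerivAt.rpow_const ((hasDerivAt_id x).const_add 1) (Or.inl h1.ne')
      have d2 : HasDerivAt (fun x : ℝ => (1 - x) ^ p) (-1 * p * (1 - x) ^ (p - 1)) x :=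
        HasDerivAt.rpow_const ((hasDerivAt_id x).const_sub 1) (Or.inl h2.ne')
      have d3 : HasDerivAt (fun x : ℝ => p * (p - 1) / 2 * x ^ 2)
          (p * (p - 1) / 2 * (2 * x)) x := by
        simpa using ((hasDerivAt_id x).pow 2).const_mul (p * (p - 1) / 2)
      have D := ((d1.add d2).div_const 2).sub d3
    · exact D.differentiableAt.differentiableWithinAt
    · have e : deriv (fun a : ℝ => ((1 + a) ^ p + (1 - a) ^ p) / 2
          - p * (p - 1) / 2 * a ^ 2) x = _ := D.deriv
      rw [e]
      have := tp_k (p - 1) x (by linarith) (by linarith) hx.1.le hx.2.le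
      nlinarith
  have := hmono (Set.left_mem_Icc.2 zero_le_one) ⟨ha0, ha1⟩ ha0
  simp at this
  linarith

lemma tp_main_aux (p u v : ℝ) (hp1 : 1 ≤ p) (hp2 : p ≤ 2) (hv : 0 ≤ v) (huv : v ≤ u) :
    ((u + v) / 2) ^ 2 + (p - 1) * ((u - v) / 2) ^ 2 ≤ ((u ^ p + v ^ p) / 2) ^ (2 / p) := by
  rcases (hv.trans huv).eq_or_lt with h0 | hu
  · have : v = 0 := le_antisymm (h0 ▸ huv) hv
    subst this
    rw [← h0]
    simp
    positivity
  set m := (u + v) / 2 with hm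
  have hm0 : 0 < m := by positivity
  set a := (u - v) / (2 * m) with ha
  have ha0 : 0 ≤ a := div_nonneg (by linarith) (by positivity)
  have ha1 : a ≤ 1 := by
    rw [ha, div_le_one (by positivity)]; linarith
  have hua : u = m * (1 + a) := by rw [ha]; field_simp; linarith
  have hva : v = m * (1 - a) := by rw [ha]; field_simp; linarith
  have h1 : (u ^ p + v ^ p) / 2 = m ^ p * (((1 + a) ^ p + (1 - a) ^ p) / 2) := by
    rw [hua, hva, mul_rpow hm0.le (by linarith), mul_rpow hm0.le (by linarith)]; ring
  have h2 : ((u - v) / 2) = m * a := by rw [hua, hva]; ring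
  rw [h1, h2]
  have hb : (1 + (p - 1) * a ^ 2) ^ (p / 2) ≤ ((1 + a) ^ p + (1 - a) ^ p) / 2 := by
    refine le_trans ?_ (tp_g p a hp1 hp2 ha0 ha1)
    have h0 : 0 ≤ (p - 1) * a ^ 2 := mul_nonneg (by linarith) (sq_nonneg a)
    have := rpow_one_add_le_one_add_mul_self (s := (p - 1) * a ^ 2) (p := p / 2) (by linarith)
      (by linarith) (by linarith)
    refine this.trans (le_of_eq (by ring))
  have h0 : 0 ≤ 1 + (p - 1) * a ^ 2 := by
    have := mul_nonneg (sub_nonneg.2 hp1) (sq_nonneg a); linarith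
  calc m ^ 2 + (p - 1) * (m * a) ^ 2 = (m ^ p) ^ (2 / p) * (1 + (p - 1) * a ^ 2) := by
        rw [← rpow_mul hm0.le, mul_div_cancel₀ _ (by linarith)]
        norm_num; ring
    _ = (m ^ p) ^ (2 / p) * ((1 + (p - 1) * a ^ 2) ^ (p / 2)) ^ (2 / p) := by
        rw [← rpow_mul h0]
        have : p / 2 * (2 / p) = 1 := by field_simp
        rw [this, rpow_one]
    _ = (m ^ p * (1 + (p - 1) * a ^ 2) ^ (p / 2)) ^ (2 / p) := by
        rw [mul_rpow (by positivity) (by positivity)]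
    _ ≤ _ := by
        apply rpow_le_rpow (by positivity) _ (by positivity)
        gcongr

lemma tp_main (p u v : ℝ) (hp1 : 1 ≤ p) (hp2 : p ≤ 2) (hu : 0 ≤ u) (hv : 0 ≤ v) :
    ((u + v) / 2) ^ 2 + (p - 1) * ((u - v) / 2) ^ 2 ≤ (((u ^ p + v ^ p) / 2) ^ (1 / p)) ^ 2 := by
  have e : (((u ^ p + v ^ p) / 2) ^ (1 / p)) ^ 2 = ((u ^ p + v ^ p) / 2) ^ (2 / p) := by
    rw [← rpow_natCast, ← rpow_mul (by positivity)]; congr 1; push_cast; ring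
  rw [e]
  rcases le_total v u with h | h
  · exact tp_main_aux p u v hp1 hp2 hv h
  · have := tp_main_aux p v u hp1 hp2 hu h
    rw [add_comm u v, add_comm (u ^ p), show ((u - v) / 2) ^ 2 = ((v - u) / 2) ^ 2 by ring]
    exact this

/-- two-point two-function hypercontractive inequality -/
lemma tp_two (ρ u v s t : ℝ) (h0 : 0 ≤ ρ) (h1 : ρ ≤ 1) (hu : 0 ≤ u) (hv : 0 ≤ v)
    (hs : 0 ≤ s) (ht : 0 ≤ t) :
    (1 + ρ) / 4 * (u * s) + (1 + ρ) / 4 * (v * t) + (1 - ρ) / 4 * (u * t) + (1 - ρ) / 4 * (v * s)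
      ≤ ((u ^ (1 + ρ) + v ^ (1 + ρ)) / 2) ^ (1 / (1 + ρ)) *
        ((s ^ (1 + ρ) + t ^ (1 + ρ)) / 2) ^ (1 / (1 + ρ)) := by
  have A := tp_main (1 + ρ) u v (by linarith) (by linarith) hu hv
  have B := tp_main (1 + ρ) s t (by linarith) (by linarith) hs ht
  set X := ((u ^ (1 + ρ) + v ^ (1 + ρ)) / 2) ^ (1 / (1 + ρ))
  set Y := ((s ^ (1 + ρ) + t ^ (1 + ρ)) / 2) ^ (1 / (1 + ρ))
  have hX : 0 ≤ X := by positivity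
  have hY : 0 ≤ Y := by positivity
  refine abs_le_of_sq_le_sq (a := _) ?_ (mul_nonneg hX hY) |> (le_abs_self _).trans
  rw [mul_pow]
  refine le_trans ?_ (mul_le_mul A B (by nlinarith [sq_nonneg ((s+t)/2), sq_nonneg ((s-t)/2)]) (by positivity))
  nlinarith [mul_nonneg h0 (sq_nonneg ((u + v) * (s - t) - (u - v) * (s + t)))]


lemma tp_ennreal (ρ : ℝ) (h0 : 0 ≤ ρ) (h1 : ρ ≤ 1) (u v s t : ℝ≥0∞) :
    ENNReal.ofReal ((1 + ρ) / 4) * (u * s) + ENNReal.ofReal ((1 + ρ) / 4) * (v * t)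
      + ENNReal.ofReal ((1 - ρ) / 4) * (u * t) + ENNReal.ofReal ((1 - ρ) / 4) * (v * s)
      ≤ (2⁻¹ * u ^ (1 + ρ) + 2⁻¹ * v ^ (1 + ρ)) ^ (1 / (1 + ρ)) *
        (2⁻¹ * s ^ (1 + ρ) + 2⁻¹ * t ^ (1 + ρ)) ^ (1 / (1 + ρ)) := by
  have hp : 0 < 1 + ρ := by linarith
  have hp' : 0 < 1 / (1 + ρ) := by positivity
  have top1 : ∀ u v : ℝ≥0∞, (u = ∞ ∨ v = ∞) →
      (2⁻¹ * u ^ (1 + ρ) + 2⁻¹ * v ^ (1 + ρ)) ^ (1 / (1 + ρ)) = ∞ := by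
    rintro u v (rfl | rfl)
    · rw [ENNReal.top_rpow_of_pos hp, ENNReal.mul_top (by simp), top_add,
        ENNReal.top_rpow_of_pos hp']
    · rw [ENNReal.top_rpow_of_pos hp, ENNReal.mul_top (by simp), add_top,
        ENNReal.top_rpow_of_pos hp']
  have ne1 : ∀ u v : ℝ≥0∞, ¬ (u = 0 ∧ v = 0) →
      (2⁻¹ * u ^ (1 + ρ) + 2⁻¹ * v ^ (1 + ρ)) ^ (1 / (1 + ρ)) ≠ 0 := by
    intro u v h h'
    apply h
    rw [ENNReal.rpow_eq_zero_iff_of_pos hp'] at h'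
    simpa [ENNReal.rpow_eq_zero_iff_of_pos hp] using h'
  by_cases hz1 : u = 0 ∧ v = 0
  · simp [hz1.1, hz1.2]
  by_cases hz2 : s = 0 ∧ t = 0
  · simp [hz2.1, hz2.2]
  by_cases ht1 : u = ∞ ∨ v = ∞
  · rw [top1 u v ht1, ENNReal.top_mul (ne1 s t hz2)]; exact le_top
  by_cases ht2 : s = ∞ ∨ t = ∞
  · rw [top1 s t ht2, ENNReal.mul_top (ne1 u v hz1)]; exact le_top
  push Not at ht1 ht2
  lift u to ℝ≥0 using ht1.1
  lift v to ℝ≥0 using ht1.2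
  lift s to ℝ≥0 using ht2.1
  lift t to ℝ≥0 using ht2.2
  have key := tp_two ρ u v s t h0 h1 u.2 v.2 s.2 t.2
  have c : ∀ u v : ℝ≥0, (2⁻¹ * (u : ℝ≥0∞) ^ (1 + ρ) + 2⁻¹ * (v : ℝ≥0∞) ^ (1 + ρ)) ^ (1 / (1 + ρ))
      = ENNReal.ofReal ((((u : ℝ) ^ (1 + ρ) + (v : ℝ) ^ (1 + ρ)) / 2) ^ (1 / (1 + ρ))) := by
    intro u v
    rw [← ENNReal.ofReal_rpow_of_nonneg (by positivity) hp'.le]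
    congr 1
    rw [add_div, ENNReal.ofReal_add (by positivity) (by positivity), div_eq_inv_mul, div_eq_inv_mul,
      ENNReal.ofReal_mul (by norm_num), ENNReal.ofReal_mul (by norm_num),
      ← ENNReal.ofReal_rpow_of_nonneg (by positivity) hp.le,
      ← ENNReal.ofReal_rpow_of_nonneg (by positivity) hp.le, ENNReal.ofReal_coe_nnreal,
      ENNReal.ofReal_coe_nnreal, ENNReal.ofReal_inv_of_pos (by norm_num)]
    simp
  rw [c, c, ← ENNReal.ofReal_mul (by positivity)]
  have e : ∀ u : ℝ≥0, (u : ℝ≥0∞) = ENNReal.ofReal u := fun u => by simp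
  rw [e u, e v, e s, e t]
  have h1' : 0 ≤ 1 - ρ := by linarith
  rw [← ENNReal.ofReal_mul (by positivity), ← ENNReal.ofReal_mul (by positivity),
    ← ENNReal.ofReal_mul (by positivity), ← ENNReal.ofReal_mul (by positivity),
    ← ENNReal.ofReal_mul (by positivity), ← ENNReal.ofReal_mul (by positivity),
    ← ENNReal.ofReal_mul (by positivity), ← ENNReal.ofReal_mul (by positivity),
    ← ENNReal.ofReal_add (by positivity) (by positivity),
    ← ENNReal.ofReal_add (by positivity) (by positivity),
    ← ENNReal.ofReal_add (by positivity) (by positivity)]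
  exact ENNReal.ofReal_le_ofReal key

section HC
variable {ι : Type*} [Fintype ι]

abbrev EE (ι : Type*) := EuclideanSpace ℝ ι
abbrev VV (ι : Type*) [Fintype ι] := WithLp 2 (EE ι × EE ι)

def HCm (ρ : ℝ) (q : Measure (VV ι)) : Prop :=
  ∀ f g : EE ι → ℝ≥0∞, Measurable f → Measurable g →
    ∫⁻ z, f z.fst * g z.snd ∂q ≤
      (∫⁻ z, f z.fst ^ (1 + ρ) ∂q) ^ (1 / (1 + ρ)) * (∫⁻ z, g z.snd ^ (1 + ρ) ∂q) ^ (1 / (1 + ρ))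

lemma HCm.conv {ρ : ℝ} (h0 : 0 ≤ ρ) {π₁ π₂ : Measure (VV ι)} [IsProbabilityMeasure π₁]
    [IsProbabilityMeasure π₂] (h1 : HCm ρ π₁) (h2 : HCm ρ π₂) : HCm ρ (π₁ ∗ π₂) := by
  intro f g hf hg
  have hp : 0 < 1 + ρ := by linarith
  have mfst : Measurable (fun z : VV ι => z.fst) := by fun_prop
  have msnd : Measurable (fun z : VV ι => z.snd) := by fun_prop
  rw [Measure.lintegral_conv (by fun_prop), Measure.lintegral_conv (by fun_prop),
    Measure.lintegral_conv (by fun_prop)]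
  set F : EE ι → ℝ≥0∞ := fun a => (∫⁻ w, f (a + w.fst) ^ (1 + ρ) ∂π₂) ^ (1 / (1 + ρ)) with hF
  set G : EE ι → ℝ≥0∞ := fun a => (∫⁻ w, g (a + w.snd) ^ (1 + ρ) ∂π₂) ^ (1 / (1 + ρ)) with hG
  have mF : Measurable F := by
    apply Measurable.pow_const
    apply Measurable.lintegral_prod_right (f := fun (a : EE ι) (w : VV ι) => f (a + w.fst) ^ (1 + ρ))
    fun_prop
  have mG : Measurable G := by
    apply Measurable.pow_const
    apply Measurable.lintegral_prod_right (f := fun (a : EE ι) (w : VV ι) => g (a + w.snd) ^ (1 + ρ))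
    fun_prop
  have step : ∀ z : VV ι, ∫⁻ w, f (z + w).fst * g (z + w).snd ∂π₂ ≤ F z.fst * G z.snd := by
    intro z
    exact h2 (fun a => f (z.fst + a)) (fun a => g (z.snd + a)) (by fun_prop) (by fun_prop)
  refine (lintegral_mono step).trans ((h1 F G mF mG).trans (le_of_eq ?_))
  have : ∀ x : ℝ≥0∞, (x ^ (1 / (1 + ρ))) ^ (1 + ρ) = x := by
    intro x; rw [← ENNReal.rpow_mul, one_div, inv_mul_cancel₀ hp.ne', ENNReal.rpow_one]
  simp only [hF, hG, this]
  rfl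

/-- the correlated two point measure in direction `b` -/
noncomputable def tpM (ρ : ℝ) (b : EE ι) : Measure (VV ι) :=
  ENNReal.ofReal ((1 + ρ) / 4) • Measure.dirac (WithLp.toLp 2 (b, b))
  + ENNReal.ofReal ((1 + ρ) / 4) • Measure.dirac (WithLp.toLp 2 (-b, -b))
  + ENNReal.ofReal ((1 - ρ) / 4) • Measure.dirac (WithLp.toLp 2 (b, -b))
  + ENNReal.ofReal ((1 - ρ) / 4) • Measure.dirac (WithLp.toLp 2 (-b, b))

lemma tpM_half (ρ : ℝ) (h0 : 0 ≤ ρ) (h1 : ρ ≤ 1) :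
    ENNReal.ofReal ((1 + ρ) / 4) + ENNReal.ofReal ((1 - ρ) / 4) = 2⁻¹ := by
  rw [← ENNReal.ofReal_add (by linarith) (by linarith)]
  rw [show (1 + ρ) / 4 + (1 - ρ) / 4 = (2:ℝ)⁻¹ by ring, ENNReal.ofReal_inv_of_pos (by norm_num)]
  simp

lemma tpM_prob (ρ : ℝ) (h0 : 0 ≤ ρ) (h1 : ρ ≤ 1) (b : EE ι) : IsProbabilityMeasure (tpM ρ b) := by
  constructor
  simp only [tpM, Measure.coe_add, Measure.coe_smul, Pi.add_apply, Pi.smul_apply, measure_univ,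
    smul_eq_mul, mul_one]
  have := tpM_half ρ h0 h1
  calc _ = (ENNReal.ofReal ((1 + ρ) / 4) + ENNReal.ofReal ((1 - ρ) / 4))
      + (ENNReal.ofReal ((1 + ρ) / 4) + ENNReal.ofReal ((1 - ρ) / 4)) := by ring
    _ = 1 := by rw [this, ENNReal.inv_two_add_inv_two]

lemma tpM_HC (ρ : ℝ) (h0 : 0 ≤ ρ) (h1 : ρ ≤ 1) (b : EE ι) : HCm ρ (tpM ρ b) := by
  intro f g hf hg
  have mfst : Measurable (fun z : VV ι => z.fst) := by fun_prop
  have msnd : Measurable (fun z : VV ι => z.snd) := by fun_prop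
  have L : ∀ F : VV ι → ℝ≥0∞, Measurable F → ∫⁻ z, F z ∂(tpM ρ b) =
      ENNReal.ofReal ((1 + ρ) / 4) * F (WithLp.toLp 2 (b, b))
      + ENNReal.ofReal ((1 + ρ) / 4) * F (WithLp.toLp 2 (-b, -b))
      + ENNReal.ofReal ((1 - ρ) / 4) * F (WithLp.toLp 2 (b, -b))
      + ENNReal.ofReal ((1 - ρ) / 4) * F (WithLp.toLp 2 (-b, b)) := by
    intro F hF
    simp only [tpM, lintegral_add_measure, lintegral_smul_measure, lintegral_dirac' _ hF,
      smul_eq_mul]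
  rw [L _ (by fun_prop), L _ (by fun_prop), L _ (by fun_prop)]
  have := tp_ennreal ρ h0 h1 (f b) (f (-b)) (g b) (g (-b))
  refine this.trans (le_of_eq ?_)
  rw [← tpM_half ρ h0 h1]
  congr 2 <;> (simp only [WithLp.fst, WithLp.snd]; ring)

lemma tpM_charFun (ρ : ℝ) (h0 : 0 ≤ ρ) (h1 : ρ ≤ 1) (b : EE ι) (ζ : VV ι) :
    charFun (tpM ρ b) ζ =
      (((1 + ρ) / 2 * cos (inner ℝ b ζ.fst + inner ℝ b ζ.snd)
        + (1 - ρ) / 2 * cos (inner ℝ b ζ.fst - inner ℝ b ζ.snd) : ℝ) : ℂ) := by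
  rw [charFun_apply]
  have hi : ∀ a : VV ι, Integrable (fun z : VV ι => Complex.exp (inner ℝ z ζ * Complex.I))
      (Measure.dirac a) := fun a => by
    apply integrable_dirac; simp
  have hs : ∀ (a : VV ι) (c : ℝ), Integrable (fun z : VV ι => Complex.exp (inner ℝ z ζ * Complex.I))
      (ENNReal.ofReal c • Measure.dirac a) := fun a c => (hi a).smul_measure (by simp)
  rw [tpM, integral_add_measure, integral_add_measure, integral_add_measure]
  rotate_left
  · exact hs _ _
  · exact hs _ _
  · exact (hs _ _).add_measure (hs _ _)
  · exact hs _ _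
  · exact ((hs _ _).add_measure (hs _ _)).add_measure (hs _ _)
  · exact hs _ _
  have e1 : (0:ℝ) ≤ (1 + ρ) / 4 := by linarith
  have e2 : (0:ℝ) ≤ (1 - ρ) / 4 := by linarith
  simp only [integral_smul_measure, integral_dirac, ENNReal.toReal_ofReal e1,
    ENNReal.toReal_ofReal e2, WithLp.prod_inner_apply, inner_neg_left]
  change _ = (((1 + ρ) / 2 * cos (inner ℝ b ζ.ofLp.1 + inner ℝ b ζ.ofLp.2)
        + (1 - ρ) / 2 * cos (inner ℝ b ζ.ofLp.1 - inner ℝ b ζ.ofLp.2) : ℝ) : ℂ)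
  generalize inner ℝ b ζ.ofLp.1 = x
  generalize inner ℝ b ζ.ofLp.2 = y
  push_cast
  rw [Complex.cos, Complex.cos]
  simp only [Complex.real_smul]
  push_cast
  ring_nf
end HC


section HC2
open Filter Topology
variable {ι : Type*} [Fintype ι]

def HCP (ρ : ℝ) (ch : VV ι → ℝ) : Prop :=
  ∃ q : Measure (VV ι), IsProbabilityMeasure q ∧ HCm ρ q ∧ ∀ ζ, charFun q ζ = ch ζ

lemma HCP.mul {ρ : ℝ} (h0 : 0 ≤ ρ) {c1 c2 : VV ι → ℝ} (h1 : HCP ρ c1) (h2 : HCP ρ c2) :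
    HCP ρ (fun ζ => c1 ζ * c2 ζ) := by
  obtain ⟨q1, p1, a1, e1⟩ := h1
  obtain ⟨q2, p2, a2, e2⟩ := h2
  refine ⟨q1 ∗ q2, inferInstance, a1.conv h0 a2, fun ζ => ?_⟩
  rw [charFun_conv, e1, e2]; push_cast; rfl

noncomputable def tpc (ρ : ℝ) (b : EE ι) (ζ : VV ι) : ℝ :=
  (1 + ρ) / 2 * cos (inner ℝ b ζ.fst + inner ℝ b ζ.snd)
        + (1 - ρ) / 2 * cos (inner ℝ b ζ.fst - inner ℝ b ζ.snd)

lemma HCP.tp {ρ : ℝ} (h0 : 0 ≤ ρ) (h1 : ρ ≤ 1) (b : EE ι) : HCP ρ (tpc ρ b) :=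
  ⟨tpM ρ b, tpM_prob ρ h0 h1 b, tpM_HC ρ h0 h1 b, fun ζ => tpM_charFun ρ h0 h1 b ζ⟩

lemma HCP.one {ρ : ℝ} (h0 : 0 ≤ ρ) (h1 : ρ ≤ 1) : HCP ρ (fun _ : VV ι => (1 : ℝ)) := by
  have := HCP.tp h0 h1 (0 : EE ι)
  convert this using 2
  simp [tpc]; ring

lemma HCP.pow {ρ : ℝ} (h0 : 0 ≤ ρ) (h1 : ρ ≤ 1) {c : VV ι → ℝ} (h : HCP ρ c) (m : ℕ) :
    HCP ρ (fun ζ => c ζ ^ m) := by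
  induction m with
  | zero => simpa using HCP.one h0 h1
  | succ m ih => simpa [pow_succ] using ih.mul h0 h

lemma HCP.prod {ρ : ℝ} (h0 : 0 ≤ ρ) (h1 : ρ ≤ 1) {κ : Type*} (s : Finset κ) {c : κ → VV ι → ℝ}
    (h : ∀ k, HCP ρ (c k)) : HCP ρ (fun ζ => ∏ k ∈ s, c k ζ) := by
  classical
  induction s using Finset.induction_on with
  | empty => simpa using HCP.one h0 h1
  | insert a s ha ih => simpa [Finset.prod_insert ha] using (h a).mul h0 ih

lemma lim_cos (s : ℝ) : Tendsto (fun m : ℕ => (m : ℝ) * (cos (s / √m) - 1)) atTop (𝓝 (-(s ^ 2 / 2))) := by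
  have h : Tendsto (fun m : ℕ => -2 * (s / 2) ^ 2 * (sinc (s / 2 / √m)) ^ 2) atTop
      (𝓝 (-2 * (s / 2) ^ 2 * (sinc 0) ^ 2)) := by
    refine Tendsto.mul tendsto_const_nhds (Tendsto.pow ?_ 2)
    refine (continuous_sinc.tendsto 0).comp ?_
    exact tendsto_const_nhds.div_atTop (tendsto_sqrt_atTop.comp tendsto_natCast_atTop_atTop)
  rw [sinc_zero] at h
  have e : -2 * (s / 2) ^ 2 * (1:ℝ) ^ 2 = -(s ^ 2 / 2) := by ring
  rw [e] at h
  refine h.congr' ?_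
  filter_upwards [eventually_gt_atTop 0] with m hm
  have hm' : (0:ℝ) < √m := by positivity
  have hc : cos (s / √m) - 1 = -2 * sin (s / 2 / √m) ^ 2 := by
    rw [show s / √m = 2 * (s / 2 / √m) by ring, cos_two_mul, cos_sq']; ring
  have hs : sin (s / 2 / √m) = s / 2 / √m * sinc (s / 2 / √m) := by
    by_cases h0 : s / 2 / √m = 0
    · rw [h0]; simp
    · rw [sinc_of_ne_zero h0, mul_div_cancel₀ _ h0]
  have hmm : (m : ℝ) = √m ^ 2 := by rw [sq_sqrt (by positivity)]
  rw [hc, hs]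
  set r := √(m:ℝ)
  rw [hmm]
  field_simp

lemma lim_tpc (ρ : ℝ) (b : EE ι) (ζ : VV ι) :
    Tendsto (fun m : ℕ => tpc ρ ((√(m:ℝ))⁻¹ • b) ζ ^ m) atTop
      (𝓝 (exp (-((inner ℝ b ζ.fst) ^ 2 + 2 * ρ * inner ℝ b ζ.fst * inner ℝ b ζ.snd
        + (inner ℝ b ζ.snd) ^ 2) / 2))) := by
  set x := inner ℝ b ζ.fst
  set y := inner ℝ b ζ.snd
  have h := ((lim_cos (x + y)).const_mul ((1 + ρ) / 2)).add
    ((lim_cos (x - y)).const_mul ((1 - ρ) / 2))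
  have h2 := Real.tendsto_one_add_pow_exp_of_tendsto
    (g := fun m : ℕ => (1 + ρ) / 2 * (cos ((x + y) / √m) - 1) + (1 - ρ) / 2 * (cos ((x - y) / √m) - 1))
    (t := (1 + ρ) / 2 * -((x + y) ^ 2 / 2) + (1 - ρ) / 2 * -((x - y) ^ 2 / 2))
    (h.congr fun m => by ring)
  convert h2 using 2
  · rename_i m
    congr 1
    simp only [tpc, inner_smul_left]
    simp only [conj_trivial]
    change (1 + ρ) / 2 * cos ((√m)⁻¹ * x + (√m)⁻¹ * y) + (1 - ρ) / 2 * cos ((√m)⁻¹ * x - (√m)⁻¹ * y) = _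
    rw [← mul_add, ← mul_sub, inv_mul_eq_div, inv_mul_eq_div]; ring
  · congr 1; ring

/-- law of the correlated pair -/
noncomputable def corr (μ : Measure (EE ι)) (α : ℝ) : Measure (VV ι) :=
  (μ.prod μ).map (fun p => WithLp.toLp 2 (p.1, cos α • p.1 + sin α • p.2))

lemma corr_meas (α : ℝ) :
    Measurable (fun p : EE ι × EE ι => (WithLp.toLp 2 (p.1, cos α • p.1 + sin α • p.2) : VV ι)) := by
  fun_prop

lemma corr_charFun (μ : Measure (EE ι)) [IsProbabilityMeasure μ] (α : ℝ) (ζ : VV ι) :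
    charFun (corr μ α) ζ = charFun μ (ζ.fst + cos α • ζ.snd) * charFun μ (sin α • ζ.snd) := by
  rw [charFun_apply, corr, integral_map (corr_meas α).aemeasurable
    (by fun_prop), charFun_apply, charFun_apply, ← integral_prod_mul]
  congr 1
  funext p
  rw [← Complex.exp_add]
  congr 1
  rw [WithLp.prod_inner_apply]
  change (((inner ℝ p.1 ζ.fst + inner ℝ (cos α • p.1 + sin α • p.2) ζ.snd : ℝ) : ℂ)) * _ = _
  rw [inner_add_left, inner_smul_left, inner_smul_left, inner_add_right, inner_smul_right,
    inner_smul_right]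
  simp only [conj_trivial]
  push_cast
  ring

variable {κ : Type*} [Fintype κ]

lemma HC_seq (μ : Measure (EE ι)) [IsProbabilityMeasure μ] (b : κ → EE ι)
    (hb : ∀ ξ, charFun μ ξ = (exp (-(∑ k, (inner ℝ (b k) ξ) ^ 2) / 2) : ℝ)) (α : ℝ)
    (hα : 0 ≤ cos α) :
    ∃ q : ℕ → ProbabilityMeasure (VV ι), (∀ m, HCm (cos α) (q m : Measure (VV ι))) ∧
      ∀ q0 : ProbabilityMeasure (VV ι), (q0 : Measure (VV ι)) = corr μ α → Tendsto q atTop (𝓝 q0) := by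
  have H : ∀ m : ℕ, HCP (cos α) (fun ζ : VV ι => ∏ k, tpc (cos α) ((√(m:ℝ))⁻¹ • b k) ζ ^ m) := by
    intro m
    exact HCP.prod hα (cos_le_one α) _ fun k => (HCP.tp hα (cos_le_one α) _).pow hα (cos_le_one α) m
  have H' : ∀ m : ℕ, ∃ q : ProbabilityMeasure (VV ι), HCm (cos α) (q : Measure (VV ι)) ∧
      ∀ ζ : VV ι, charFun (q : Measure (VV ι)) ζ =
        ((∏ k, tpc (cos α) ((√(m:ℝ))⁻¹ • b k) ζ ^ m : ℝ) : ℂ) := by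
    intro m
    obtain ⟨q, hp, h1, h2⟩ := H m
    exact ⟨⟨q, hp⟩, h1, h2⟩
  choose q h1 h2 using H'
  refine ⟨q, h1, fun q0 hq0 => ?_⟩
  rw [ProbabilityMeasure.tendsto_iff_tendsto_charFun]
  intro ζ
  rw [hq0, corr_charFun, hb, hb]
  simp only [h2]
  rw [← Complex.ofReal_mul, ← Real.exp_add]
  refine (Complex.continuous_ofReal.tendsto _).comp ?_
  have := tendsto_finsetProd (Finset.univ) fun k _ => lim_tpc (cos α) (b k) ζ
  rw [← Real.exp_sum] at this
  convert this using 3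
  rw [← Finset.sum_div, ← Finset.sum_neg_distrib, ← Finset.sum_neg_distrib, ← add_div,
    ← Finset.sum_add_distrib]
  congr 1
  refine Finset.sum_congr rfl fun k _ => ?_
  rw [inner_add_right, inner_smul_right, inner_smul_right]
  have := sin_sq α
  set x := inner ℝ (b k) ζ.fst
  set y := inner ℝ (b k) ζ.snd
  rw [mul_pow, this]
  ring

lemma gauss_HC_bdd (μ : Measure (EE ι)) [IsProbabilityMeasure μ] (b : κ → EE ι)
    (hb : ∀ ξ, charFun μ ξ = (exp (-(∑ k, (inner ℝ (b k) ξ) ^ 2) / 2) : ℝ)) (α : ℝ)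
    (hα : 0 ≤ cos α) (f g : EE ι → ℝ≥0) (hf : Continuous f) (hg : Continuous g) (n : ℝ≥0)
    (hfn : ∀ x, f x ≤ n) (hgn : ∀ x, g x ≤ n) :
    ∫⁻ z, (f z.fst : ℝ≥0∞) * g z.snd ∂(corr μ α) ≤
      (∫⁻ z, (f z.fst : ℝ≥0∞) ^ (1 + cos α) ∂(corr μ α)) ^ (1 / (1 + cos α)) *
      (∫⁻ z, (g z.snd : ℝ≥0∞) ^ (1 + cos α) ∂(corr μ α)) ^ (1 / (1 + cos α)) := by
  obtain ⟨q, hq1, hq2⟩ := HC_seq μ b hb α hα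
  have hp : 0 < 1 + cos α := by linarith
  have hprob : IsProbabilityMeasure (corr μ α) := Measure.isProbabilityMeasure_map (corr_meas α).aemeasurable
  obtain ⟨q0, hq0⟩ : ∃ q0 : ProbabilityMeasure (VV ι), (q0 : Measure (VV ι)) = corr μ α :=
    ⟨⟨corr μ α, hprob⟩, rfl⟩
  have hlim := hq2 q0 hq0
  rw [ProbabilityMeasure.tendsto_iff_forall_lintegral_tendsto] at hlim
  have cfst : Continuous (fun z : VV ι => z.fst) := by fun_prop
  have csnd : Continuous (fun z : VV ι => z.snd) := by fun_prop
  have key : ∀ (F : VV ι → ℝ≥0) (c : ℝ≥0), Continuous F → (∀ z, F z ≤ c) →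
      Tendsto (fun m => ∫⁻ z, (F z : ℝ≥0∞) ∂(q m : Measure (VV ι))) atTop
        (𝓝 (∫⁻ z, (F z : ℝ≥0∞) ∂(corr μ α))) := by
    intro F c hF hc
    have := hlim (BoundedContinuousFunction.mkOfBound ⟨F, hF⟩ c (fun x y => by
      change dist (F x) (F y) ≤ c
      rw [NNReal.dist_eq, abs_le]
      have h1 : (F x : ℝ) ≤ c := by exact_mod_cast hc x
      have h2 : (F y : ℝ) ≤ c := by exact_mod_cast hc y
      constructor <;> linarith [(F x).2, (F y).2, NNReal.coe_nonneg (F x), NNReal.coe_nonneg (F y)]))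
    rw [hq0] at this
    exact this
  have fin : ∀ (F : VV ι → ℝ≥0) (c : ℝ≥0), (∀ z, F z ≤ c) →
      ∫⁻ z, (F z : ℝ≥0∞) ∂(corr μ α) ≠ ∞ := by
    intro F c hc
    have : ∫⁻ z, (F z : ℝ≥0∞) ∂(corr μ α) ≤ ∫⁻ z, (c : ℝ≥0∞) ∂(corr μ α) :=
      lintegral_mono fun z => ENNReal.coe_le_coe.2 (hc z)
    refine ne_top_of_le_ne_top ?_ this
    simp
  have bf : ∀ z : VV ι, f z.fst ^ (1 + cos α) ≤ n ^ (1 + cos α) := fun z =>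
    NNReal.rpow_le_rpow (hfn _) hp.le
  have bg : ∀ z : VV ι, g z.snd ^ (1 + cos α) ≤ n ^ (1 + cos α) := fun z =>
    NNReal.rpow_le_rpow (hgn _) hp.le
  have k1 := key (fun z => f z.fst * g z.snd) (n * n) (by fun_prop)
    (fun z => mul_le_mul' (hfn _) (hgn _))
  have k2 := key (fun z => f z.fst ^ (1 + cos α)) (n ^ (1 + cos α))
    ((NNReal.continuous_rpow_const hp.le).comp (hf.comp cfst)) bf
  have k3 := key (fun z => g z.snd ^ (1 + cos α)) (n ^ (1 + cos α))
    ((NNReal.continuous_rpow_const hp.le).comp (hg.comp csnd)) bg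
  have t2 := fin _ _ bf
  have t3 := fin _ _ bg
  have hp' : 0 ≤ 1 / (1 + cos α) := by positivity
  have k4 := ENNReal.Tendsto.mul (k2.ennrpow_const (1 / (1 + cos α)))
    (Or.inr (ENNReal.rpow_ne_top_of_nonneg hp' t3)) (k3.ennrpow_const (1 / (1 + cos α)))
    (Or.inr (ENNReal.rpow_ne_top_of_nonneg hp' t2))
  simp only [ENNReal.coe_mul, ENNReal.coe_rpow_of_nonneg _ hp.le] at k1 k4
  refine le_of_tendsto_of_tendsto' k1 k4 fun m => ?_
  exact hq1 m (fun x => f x) (fun x => g x) (by fun_prop) (by fun_prop)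

lemma gauss_HC (μ : Measure (EE ι)) [IsGaussian μ] (h0 : μ[id] = 0) (b : κ → EE ι)
    (hb : ∀ ξ, charFun μ ξ = (exp (-(∑ k, (inner ℝ (b k) ξ) ^ 2) / 2) : ℝ)) (α : ℝ)
    (hα : 0 ≤ cos α) (f g : EE ι → ℝ≥0) (hf : Continuous f) (hg : Continuous g) :
    ∫⁻ p, (f p.1 : ℝ≥0∞) * g (cos α • p.1 + sin α • p.2) ∂(μ.prod μ) ≤
      (∫⁻ x, (f x : ℝ≥0∞) ^ (1 + cos α) ∂μ) ^ (1 / (1 + cos α)) *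
      (∫⁻ x, (g x : ℝ≥0∞) ^ (1 + cos α) ∂μ) ^ (1 / (1 + cos α)) := by
  have hp : 0 < 1 + cos α := by linarith
  have hp' : 0 ≤ 1 / (1 + cos α) := by positivity
  have mfst : Measurable (fun z : VV ι => z.fst) := by fun_prop
  have msnd : Measurable (fun z : VV ι => z.snd) := by fun_prop
  have e1 : ∀ h : EE ι → ℝ≥0∞, Measurable h → ∫⁻ z, h z.fst ∂(corr μ α) = ∫⁻ x, h x ∂μ := by
    intro h hh
    rw [corr, lintegral_map (by fun_prop) (corr_meas α)]
    change ∫⁻ p, h p.1 ∂(μ.prod μ) = _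
    rw [← (measurePreserving_fst (μ := μ) (ν := μ)).lintegral_comp hh]
  have e2 : ∀ h : EE ι → ℝ≥0∞, Measurable h → ∫⁻ z, h z.snd ∂(corr μ α) = ∫⁻ x, h x ∂μ := by
    intro h hh
    rw [corr, lintegral_map (by fun_prop) (corr_meas α)]
    have r : MeasurePreserving (ContinuousLinearMap.rotation (E := EE ι) α) (μ.prod μ) (μ.prod μ) :=
      ⟨by fun_prop, IsGaussian.map_rotation_eq_self h0 α⟩
    rw [← ((measurePreserving_fst (μ := μ) (ν := μ)).comp r).lintegral_comp hh]
    rfl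
  have e3 : ∀ f g : EE ι → ℝ≥0∞, Measurable f → Measurable g → ∫⁻ z, f z.fst * g z.snd ∂(corr μ α)
      = ∫⁻ p, f p.1 * g (cos α • p.1 + sin α • p.2) ∂(μ.prod μ) := by
    intro f g hf hg
    rw [corr, lintegral_map (by fun_prop) (corr_meas α)]
    rfl
  have B : ∀ n : ℕ, ∫⁻ p, (min (f p.1) n : ℝ≥0∞) * (min (g (cos α • p.1 + sin α • p.2)) n : ℝ≥0∞)
      ∂(μ.prod μ) ≤ (∫⁻ x, (f x : ℝ≥0∞) ^ (1 + cos α) ∂μ) ^ (1 / (1 + cos α)) *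
      (∫⁻ x, (g x : ℝ≥0∞) ^ (1 + cos α) ∂μ) ^ (1 / (1 + cos α)) := by
    intro n
    have := gauss_HC_bdd μ b hb α hα (fun x => min (f x) n) (fun x => min (g x) n)
      (by fun_prop) (by fun_prop) n (fun x => min_le_right _ _) (fun x => min_le_right _ _)
    rw [e3 (fun x => ((min (f x) n : ℝ≥0) : ℝ≥0∞)) (fun x => ((min (g x) n : ℝ≥0) : ℝ≥0∞))
      (by fun_prop) (by fun_prop),
      e1 (fun x => ((min (f x) n : ℝ≥0) : ℝ≥0∞) ^ (1 + cos α)) (by fun_prop),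
      e2 (fun x => ((min (g x) n : ℝ≥0) : ℝ≥0∞) ^ (1 + cos α)) (by fun_prop)] at this
    simp only [ENNReal.coe_min, ENNReal.coe_natCast] at this
    refine this.trans ?_
    gcongr <;> exact min_le_left _ _
  have L : Tendsto (fun n : ℕ => ∫⁻ p, (min (f p.1) n : ℝ≥0∞) *
      (min (g (cos α • p.1 + sin α • p.2)) n : ℝ≥0∞) ∂(μ.prod μ)) atTop
      (𝓝 (∫⁻ p, (f p.1 : ℝ≥0∞) * g (cos α • p.1 + sin α • p.2) ∂(μ.prod μ))) := by
    refine lintegral_tendsto_of_tendsto_of_monotone (fun n => by fun_prop) ?_ ?_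
    · filter_upwards with p n m hnm
      have : (n : ℝ≥0∞) ≤ m := by exact_mod_cast hnm
      simp only
      gcongr
    · filter_upwards with p
      refine tendsto_const_nhds.congr' ?_
      obtain ⟨N, hN⟩ := exists_nat_ge (max (f p.1) (g (cos α • p.1 + sin α • p.2)))
      filter_upwards [eventually_ge_atTop N] with n hn
      have hn' : (N : ℝ≥0) ≤ n := by exact_mod_cast hn
      have a1 : (f p.1 : ℝ≥0∞) ≤ n := by
        exact_mod_cast ((le_max_left _ _).trans hN).trans hn'
      have a2 : (g (cos α • p.1 + sin α • p.2) : ℝ≥0∞) ≤ n := by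
        exact_mod_cast ((le_max_right _ _).trans hN).trans hn'
      rw [min_eq_left a1, min_eq_left a2]
  exact le_of_tendsto' L B

end HC2


section UGsec
variable {V W : Type*} [NormedAddCommGroup V] [NormedSpace ℝ V]
  [NormedAddCommGroup W] [NormedSpace ℝ W] {T S : Type*}

/-- uniformly of exponential growth -/
def UG (Φ : T → V → ℝ) : Prop :=
  (∀ t, Continuous (Φ t)) ∧ ∃ C a : ℝ, 0 ≤ C ∧ 0 ≤ a ∧ ∀ t x, |Φ t x| ≤ C * exp (a * ‖x‖)

def EG (F : V → ℝ) : Prop := UG (fun _ : Unit => F)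

lemma EG.cont {F : V → ℝ} (h : EG F) : Continuous F := h.1 ()

lemma EG.const {F : V → ℝ} (h : EG F) : UG (fun _ : T => F) := by
  obtain ⟨h1, C, a, hC, ha, h2⟩ := h
  exact ⟨fun _ => h1 (), C, a, hC, ha, fun _ x => h2 () x⟩

lemma UG.at {Φ : T → V → ℝ} (h : UG Φ) (t : T) : EG (Φ t) := by
  obtain ⟨h1, C, a, hC, ha, h2⟩ := h
  exact ⟨fun _ => h1 t, C, a, hC, ha, fun _ x => h2 t x⟩

lemma UG.mul {Φ Ψ : T → V → ℝ} (h : UG Φ) (h' : UG Ψ) : UG (fun t x => Φ t x * Ψ t x) := by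
  obtain ⟨h1, C, a, hC, ha, h2⟩ := h
  obtain ⟨h1', C', a', hC', ha', h2'⟩ := h'
  refine ⟨fun t => (h1 t).mul (h1' t), C * C', a + a', by positivity, by positivity, fun t x => ?_⟩
  rw [abs_mul, add_mul, exp_add]
  calc _ ≤ (C * exp (a * ‖x‖)) * (C' * exp (a' * ‖x‖)) :=
        mul_le_mul (h2 t x) (h2' t x) (abs_nonneg _) (by positivity)
    _ = _ := by ring

lemma UG.add {Φ Ψ : T → V → ℝ} (h : UG Φ) (h' : UG Ψ) : UG (fun t x => Φ t x + Ψ t x) := by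
  obtain ⟨h1, C, a, hC, ha, h2⟩ := h
  obtain ⟨h1', C', a', hC', ha', h2'⟩ := h'
  refine ⟨fun t => (h1 t).add (h1' t), C + C', a + a', by positivity, by positivity, fun t x => ?_⟩
  refine (abs_add_le _ _).trans ?_
  rw [add_mul C]
  have e1 : exp (a * ‖x‖) ≤ exp ((a + a') * ‖x‖) := by
    apply exp_le_exp.2; nlinarith [norm_nonneg x]
  have e2 : exp (a' * ‖x‖) ≤ exp ((a + a') * ‖x‖) := by
    apply exp_le_exp.2; nlinarith [norm_nonneg x]
  exact add_le_add ((h2 t x).trans (by gcongr)) ((h2' t x).trans (by gcongr))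

lemma UG.sum {κ : Type*} (s : Finset κ) {Φ : κ → T → V → ℝ} (h : ∀ k, UG (Φ k)) :
    UG (fun t x => ∑ k ∈ s, Φ k t x) := by
  classical
  induction s using Finset.induction_on with
  | empty => exact ⟨fun t => by simpa using continuous_const, 0, 0, le_rfl, le_rfl, by simp⟩
  | insert a s ha ih => simpa [Finset.sum_insert ha] using (h a).add ih

lemma UG.bdd {c : T → ℝ} {K : ℝ} (hc : ∀ t, |c t| ≤ K) : UG (fun t (_ : V) => c t) := by
  refine ⟨fun t => continuous_const, |K|, 0, abs_nonneg _, le_rfl, fun t x => ?_⟩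
  simpa using (hc t).trans (le_abs_self K)

lemma UG.comp {Φ : T → W → ℝ} (h : UG Φ) (τ : S → T) {L : S → V → W} (hL : ∀ s, Continuous (L s))
    {A B : ℝ} (hb : ∀ s x, ‖L s x‖ ≤ A + B * ‖x‖) : UG (fun s x => Φ (τ s) (L s x)) := by
  obtain ⟨h1, C, a, hC, ha, h2⟩ := h
  refine ⟨fun s => (h1 _).comp (hL s), C * exp (a * A), a * |B|, by positivity, by positivity,
    fun s x => ?_⟩
  refine (h2 _ _).trans ?_
  rw [mul_assoc, ← exp_add]
  gcongr
  have : B * ‖x‖ ≤ |B| * ‖x‖ := by gcongr; exact le_abs_self B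
  have := hb s x
  calc a * ‖L s x‖ ≤ a * (A + |B| * ‖x‖) := by gcongr; linarith
    _ = _ := by ring

lemma UG.clm (L : T → V →L[ℝ] ℝ) {B : ℝ} (hb : ∀ t x, |L t x| ≤ B * ‖x‖) : UG (fun t x => L t x) := by
  refine ⟨fun t => (L t).continuous, |B|, 1, abs_nonneg _, zero_le_one, fun t x => ?_⟩
  refine (hb t x).trans ?_
  have : ‖x‖ ≤ exp (1 * ‖x‖) := by linarith [add_one_le_exp (1 * ‖x‖)]
  calc B * ‖x‖ ≤ |B| * ‖x‖ := by gcongr; exact le_abs_self B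
    _ ≤ _ := by gcongr

variable [MeasurableSpace V] [BorelSpace V] [CompleteSpace V] [SecondCountableTopology V]

lemma exp_norm_int (ν : Measure V) [IsGaussian ν] (a : ℝ) :
    Integrable (fun x => exp (a * ‖x‖)) ν := by
  obtain ⟨C, hC, h⟩ := IsGaussian.exists_integrable_exp_sq ν
  refine (h.const_mul (exp (a ^ 2 / (4 * C)))).mono' (by fun_prop) ?_
  filter_upwards with x
  rw [norm_of_nonneg (by positivity), ← exp_add]
  apply exp_le_exp.2
  have : a ^ 2 / (4 * C) + C * ‖x‖ ^ 2 - a * ‖x‖ = C * (‖x‖ - a / (2 * C)) ^ 2 := by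
    field_simp; ring
  nlinarith [sq_nonneg (‖x‖ - a / (2 * C))]

lemma EG.int {F : V → ℝ} (h : EG F) (ν : Measure V) [IsGaussian ν] : Integrable F ν := by
  obtain ⟨h1, C, a, hC, ha, h2⟩ := h
  refine ((exp_norm_int ν a).const_mul C).mono' (h1 ()).aestronglyMeasurable ?_
  filter_upwards with x using h2 () x

lemma UG.deriv {Φ Φ' : ℝ → V → ℝ} (ν : Measure V) [IsGaussian ν] (h : UG Φ) (h' : UG Φ')
    (hd : ∀ t x, HasDerivAt (fun t => Φ t x) (Φ' t x) t) (t : ℝ) :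
    HasDerivAt (fun t => ∫ x, Φ t x ∂ν) (∫ x, Φ' t x ∂ν) t := by
  obtain ⟨h1, C, a, hC, ha, h2⟩ := h'
  refine (hasDerivAt_integral_of_dominated_loc_of_deriv_le (F := Φ) (F' := Φ')
    (bound := fun x => C * exp (a * ‖x‖)) (s := Set.univ) (Filter.univ_mem)
    ?_ ((h.at t).int ν) (h1 t).aestronglyMeasurable ?_ ((exp_norm_int ν a).const_mul C) ?_).2
  · filter_upwards with s using (h.1 s).aestronglyMeasurable
  · filter_upwards with x s _ using h2 s x
  · filter_upwards with x s _ using hd s x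
end UGsec


section interp
variable {ι : Type*} [Fintype ι]

structure C1E (F : EE ι → ℝ) (F' : ι → EE ι → ℝ) : Prop where
  deriv : ∀ x, HasFDerivAt F (∑ j, F' j x • (EuclideanSpace.proj j : EE ι →L[ℝ] ℝ)) x
  eg : EG F
  eg' : ∀ j, EG (F' j)

lemma C1E.hasDeriv {F : EE ι → ℝ} {F' : ι → EE ι → ℝ} (h : C1E F F') {γ : ℝ → EE ι} {γ' : EE ι} {t : ℝ}
    (hγ : HasDerivAt γ γ' t) : HasDerivAt (fun t => F (γ t)) (∑ j, F' j (γ t) * γ' j) t := by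
  have := (h.deriv (γ t)).comp_hasDerivAt t hγ
  have e : (∑ j, F' j (γ t) • (EuclideanSpace.proj j : EE ι →L[ℝ] ℝ)) γ' = ∑ j, F' j (γ t) * γ' j := by
    simp
  rw [e] at this
  exact this

lemma rot_bound (α : ℝ) (p : EE ι × EE ι) : ‖cos α • p.1 + sin α • p.2‖ ≤ 0 + 2 * ‖p‖ := by
  have h1 : ‖p.1‖ ≤ ‖p‖ := norm_fst_le p
  have h2 : ‖p.2‖ ≤ ‖p‖ := norm_snd_le p
  have h3 : ‖cos α • p.1‖ ≤ 1 * ‖p.1‖ := by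
    rw [norm_smul]; gcongr; exact abs_cos_le_one α
  have h4 : ‖sin α • p.2‖ ≤ 1 * ‖p.2‖ := by
    rw [norm_smul]; gcongr; exact abs_sin_le_one α
  linarith [norm_add_le (cos α • p.1) (sin α • p.2)]

lemma rot_bound' (α : ℝ) (p : EE ι × EE ι) : ‖-sin α • p.1 + cos α • p.2‖ ≤ 0 + 2 * ‖p‖ := by
  have := rot_bound (α + π / 2) p
  rwa [cos_add_pi_div_two, sin_add_pi_div_two] at this

lemma coord_le (x : EE ι) (j : ι) : |x j| ≤ ‖x‖ := by
  simpa using EuclideanSpace.norm_eq x ▸ PiLp.norm_apply_le x j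

lemma coord_EG (j : ι) : EG (fun x : EE ι => x j) := by
  refine UG.clm (fun _ => EuclideanSpace.proj j) (B := 1) fun _ x => ?_
  simpa using coord_le x j

lemma hasDeriv_rot (p : EE ι × EE ι) (α : ℝ) :
    HasDerivAt (fun α => cos α • p.1 + sin α • p.2) (-sin α • p.1 + cos α • p.2) α :=
  ((hasDerivAt_cos α).smul_const p.1).add ((hasDerivAt_sin α).smul_const p.2)

variable (μ : Measure (EE ι)) [IsGaussian μ]

lemma int_rot (h0 : μ[id] = 0) (α : ℝ) (H : EE ι × EE ι → ℝ) (hH : Continuous H) :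
    ∫ p, H (cos α • p.1 + sin α • p.2, -sin α • p.1 + cos α • p.2) ∂(μ.prod μ) = ∫ p, H p ∂(μ.prod μ) := by
  conv_rhs => rw [← IsGaussian.map_rotation_eq_self h0 α]
  rw [integral_map (by fun_prop) hH.aestronglyMeasurable]
  rfl

lemma coord_zero (h0 : μ[id] = 0) (j : ι) : ∫ x, x j ∂μ = 0 := by
  have := IsGaussian.integral_dual (μ := μ) (EuclideanSpace.proj j : EE ι →L[ℝ] ℝ)
  simp only [id] at h0
  rw [h0] at this
  simpa using this

noncomputable def cv (i j : ι) : ℝ := ∫ x, x i * x j ∂μ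

lemma ibp (h0 : μ[id] = 0) {F : EE ι → ℝ} {F' : ι → EE ι → ℝ} (h : C1E F F') (j : ι) :
    ∫ x, F x * x j ∂μ = ∑ i, cv μ i j * ∫ x, F' i x ∂μ := by
  have cr : ∀ α : ℝ, Continuous fun p : EE ι × EE ι => cos α • p.1 + sin α • p.2 := fun α => by fun_prop
  have cr' : ∀ α : ℝ, Continuous fun p : EE ι × EE ι => -sin α • p.1 + cos α • p.2 := fun α => by fun_prop
  have u1 : UG (fun (α : ℝ) (p : EE ι × EE ι) => F (cos α • p.1 + sin α • p.2)) :=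
    h.eg.comp (fun _ => ()) cr rot_bound
  have u2 : UG (fun (α : ℝ) (p : EE ι × EE ι) => (-sin α • p.1 + cos α • p.2) j) :=
    (coord_EG j).comp (fun _ => ()) cr' rot_bound'
  have u2' : UG (fun (α : ℝ) (p : EE ι × EE ι) => (cos α • p.1 + sin α • p.2) j) :=
    (coord_EG j).comp (fun _ => ()) cr rot_bound
  have u3 : UG (fun (α : ℝ) (p : EE ι × EE ι) =>
      ∑ i, F' i (cos α • p.1 + sin α • p.2) * (-sin α • p.1 + cos α • p.2) i) :=
    UG.sum _ fun i => UG.mul ((h.eg' i).comp (fun _ => ()) cr rot_bound)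
      ((coord_EG i).comp (fun _ => ()) cr' rot_bound')
  have u4 : UG (fun (α : ℝ) (p : EE ι × EE ι) =>
      (∑ i, F' i (cos α • p.1 + sin α • p.2) * (-sin α • p.1 + cos α • p.2) i)
        * (-sin α • p.1 + cos α • p.2) j
      + F (cos α • p.1 + sin α • p.2) * ((-1) * (cos α • p.1 + sin α • p.2) j)) :=
    (u3.mul u2).add (u1.mul ((UG.bdd (K := 1) (fun _ => by simp)).mul u2'))
  have D := UG.deriv (μ.prod μ) (u1.mul u2) u4 (fun α p => by
    refine (h.hasDeriv (hasDeriv_rot p α)).mul ?_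
    simp only [PiLp.add_apply, PiLp.smul_apply, smul_eq_mul]
    convert! ((hasDerivAt_sin α).neg.mul_const (p.1 j)).add ((hasDerivAt_cos α).mul_const (p.2 j)) using 1
    ring) 0
  have Z : ∀ α : ℝ, ∫ p : EE ι × EE ι, F (cos α • p.1 + sin α • p.2) * (-sin α • p.1 + cos α • p.2) j
      ∂(μ.prod μ) = 0 := by
    intro α
    have := int_rot μ h0 α (fun p => F p.1 * p.2 j) (by have := h.eg.cont; fun_prop)
    simp only at this
    rw [this]
    rw [integral_prod_mul F (fun x : EE ι => x j), coord_zero μ h0, mul_zero]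
  simp only [Z] at D
  have D' := D.unique (hasDerivAt_const (0:ℝ) (0:ℝ))
  simp only [cos_zero, sin_zero, one_smul, zero_smul, add_zero, neg_zero, zero_add] at D'
  have ig : ∀ i, Integrable (fun p : EE ι × EE ι => F' i p.1 * (p.2 i * p.2 j)) (μ.prod μ) := fun i =>
    Integrable.mul_prod ((h.eg' i).int μ) (((coord_EG i).mul (coord_EG j)).at () |>.int μ)
  have ig2 : Integrable (fun p : EE ι × EE ι => F p.1 * (-1 * p.1 j)) (μ.prod μ) := by
    have := (((h.eg.mul (coord_EG j)).at () |>.int μ).neg).comp_fst μ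
    refine this.congr ?_
    filter_upwards with p
    simp
  simp only [Finset.sum_mul, mul_assoc] at D'
  rw [integral_add (integrable_finsetSum _ fun i _ => ig i) ig2,
    integral_finsetSum _ fun i _ => ig i] at D'
  have e1 : ∀ i, ∫ p : EE ι × EE ι, F' i p.1 * (p.2 i * p.2 j) ∂(μ.prod μ) = cv μ i j * ∫ x, F' i x ∂μ := by
    intro i
    rw [integral_prod_mul (F' i) (fun x : EE ι => x i * x j), cv, mul_comm]
  have e2 : ∫ p : EE ι × EE ι, F p.1 * (-1 * p.1 j) ∂(μ.prod μ) = - ∫ x, F x * x j ∂μ := by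
    have := integral_prod_mul (μ := μ) (ν := μ) (fun x => F x * (-1 * x j)) (fun _ => 1)
    simp only [mul_one, integral_const, probReal_univ, smul_eq_mul] at this
    rw [this, ← integral_neg]
    congr 1; funext x; ring
  simp only [e1, e2] at D'
  linarith
end interp


section interp2
variable {ι : Type*} [Fintype ι] (μ : Measure (EE ι)) [IsGaussian μ]

lemma C1E.shift {F : EE ι → ℝ} {F' : ι → EE ι → ℝ} (h : C1E F F') (u : EE ι) (s : ℝ) :
    C1E (fun v => F (u + s • v)) (fun i v => s * F' i (u + s • v)) := by
  have hb : ∀ (_ : Unit) (v : EE ι), ‖u + s • v‖ ≤ ‖u‖ + |s| * ‖v‖ := fun _ v => by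
    refine (norm_add_le _ _).trans ?_
    rw [norm_smul]; rfl
  have hc : ∀ _ : Unit, Continuous fun v : EE ι => u + s • v := fun _ => by fun_prop
  refine ⟨fun x => ?_, h.eg.comp (fun _ => ()) hc hb, fun j =>
    UG.mul (UG.bdd (K := |s|) fun _ => le_rfl) ((h.eg' j).comp (fun _ => ()) hc hb)⟩
  have hL : HasFDerivAt (fun v : EE ι => u + s • v) (s • ContinuousLinearMap.id ℝ (EE ι)) x :=
    ((hasFDerivAt_id x).const_smul s).const_add u
  have := (h.deriv (u + s • x)).comp x hL
  convert! this using 1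
  ext v
  simp [Finset.mul_sum]
  refine Finset.sum_congr rfl fun i _ => by ring

noncomputable def psi (F G : EE ι → ℝ) (α : ℝ) : ℝ :=
  ∫ p, F p.1 * G (cos α • p.1 + sin α • p.2) ∂(μ.prod μ)

lemma psi_deriv (h0 : μ[id] = 0) {F G : EE ι → ℝ} {F' G' : ι → EE ι → ℝ} (h : C1E F F')
    (k : C1E G G') (α : ℝ) :
    HasDerivAt (psi μ F G) (-sin α * ∑ i, ∑ j, cv μ i j * psi μ (F' i) (G' j) α) α := by
  have cr : ∀ α : ℝ, Continuous fun p : EE ι × EE ι => cos α • p.1 + sin α • p.2 := fun α => by fun_prop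
  have cr' : ∀ α : ℝ, Continuous fun p : EE ι × EE ι => -sin α • p.1 + cos α • p.2 := fun α => by fun_prop
  have fstEG : ∀ {H : EE ι → ℝ}, EG H → EG (fun p : EE ι × EE ι => H p.1) := fun {H} hH =>
    hH.comp (fun _ => ()) (S := Unit) (V := EE ι × EE ι) (L := fun _ p => p.1) (A := 0) (B := 1) (fun _ => continuous_fst)
      (fun _ p => by simpa using norm_fst_le p)
  have sndEG : ∀ {H : EE ι → ℝ}, EG H → EG (fun p : EE ι × EE ι => H p.2) := fun {H} hH =>
    hH.comp (fun _ => ()) (S := Unit) (V := EE ι × EE ι) (L := fun _ p => p.2) (A := 0) (B := 1) (fun _ => continuous_snd)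
      (fun _ p => by simpa using norm_snd_le p)
  have u0 : UG (fun (_ : ℝ) (p : EE ι × EE ι) => F p.1) := (fstEG h.eg).const
  have u1 : UG (fun (α : ℝ) (p : EE ι × EE ι) => G (cos α • p.1 + sin α • p.2)) :=
    k.eg.comp (fun _ => ()) cr rot_bound
  have u3 : UG (fun (α : ℝ) (p : EE ι × EE ι) =>
      ∑ j, G' j (cos α • p.1 + sin α • p.2) * (-sin α • p.1 + cos α • p.2) j) :=
    UG.sum _ fun i => UG.mul ((k.eg' i).comp (fun _ => ()) cr rot_bound)
      ((coord_EG i).comp (fun _ => ()) cr' rot_bound')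
  have D := UG.deriv (μ.prod μ) (u0.mul u1) (u0.mul u3) (fun α p =>
    (k.hasDeriv (hasDeriv_rot p α)).const_mul (F p.1)) α
  convert! D using 1
  -- inverse rotation
  have cF : EG (fun p : EE ι × EE ι => F (cos α • p.1 + (-sin α) • p.2)) := by
    have := (h.eg.comp (fun _ => ()) cr rot_bound).at (-α)
    simpa using this
  have cF' : ∀ i, EG (fun p : EE ι × EE ι => F' i (cos α • p.1 + (-sin α) • p.2)) := fun i => by
    have := ((h.eg' i).comp (fun _ => ()) cr rot_bound).at (-α)
    simpa using this
  have hrot : ∀ p : EE ι × EE ι, cos α • (cos α • p.1 + sin α • p.2) +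
      (-sin α) • (-sin α • p.1 + cos α • p.2) = p.1 := by
    intro p
    have : cos α * cos α + sin α * sin α = 1 := by nlinarith [sin_sq_add_cos_sq α]
    calc _ = (cos α * cos α + sin α * sin α) • p.1 := by module
      _ = _ := by rw [this, one_smul]
  have e1 : ∫ p, F p.1 * ∑ j, G' j (cos α • p.1 + sin α • p.2) * (-sin α • p.1 + cos α • p.2) j
      ∂(μ.prod μ) = ∫ p : EE ι × EE ι, F (cos α • p.1 + (-sin α) • p.2) * ∑ j, G' j p.1 * p.2 j ∂(μ.prod μ) := by
    have cG := fun j => (k.eg' j).cont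
    have cFc := h.eg.cont
    have := int_rot μ h0 α (fun p => F (cos α • p.1 + (-sin α) • p.2) * ∑ j, G' j p.1 * p.2 j) (by fun_prop)
    rw [← this]
    simp only [hrot]
  rw [e1]
  have e2 : ∀ i j, psi μ (F' i) (G' j) α = ∫ p : EE ι × EE ι, F' i (cos α • p.1 + (-sin α) • p.2) * G' j p.1
      ∂(μ.prod μ) := by
    intro i j
    have cG := fun j => (k.eg' j).cont
    have cFc := (h.eg' i).cont
    have := int_rot μ h0 α (fun p => F' i (cos α • p.1 + (-sin α) • p.2) * G' j p.1) (by fun_prop)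
    rw [← this]
    simp only [hrot, psi]
  have i1 : ∀ j, Integrable (fun p : EE ι × EE ι => F (cos α • p.1 + (-sin α) • p.2) * (G' j p.1 * p.2 j))
      (μ.prod μ) := fun j =>
    ((cF.mul ((fstEG (k.eg' j)).mul (sndEG (coord_EG j)))).at ()).int _
  have i2 : ∀ i j, Integrable (fun p : EE ι × EE ι => F' i (cos α • p.1 + (-sin α) • p.2) * G' j p.1)
      (μ.prod μ) := fun i j => (((cF' i).mul (fstEG (k.eg' j))).at ()).int _
  simp only [Finset.mul_sum]
  rw [integral_finsetSum _ fun j _ => i1 j, Finset.sum_comm]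
  refine Finset.sum_congr rfl fun j _ => ?_
  rw [integral_prod _ (i1 j)]
  have e3 : ∀ u : EE ι, ∫ v, F (cos α • u + (-sin α) • v) * (G' j u * v j) ∂μ
      = ∑ i, -sin α * cv μ i j * ∫ v, F' i (cos α • u + (-sin α) • v) * G' j u ∂μ := by
    intro u
    have := ibp μ h0 (h.shift (cos α • u) (-sin α)) j
    have c : ∫ v, F (cos α • u + (-sin α) • v) * (G' j u * v j) ∂μ
      = G' j u * ∫ v, F (cos α • u + (-sin α) • v) * v j ∂μ := by
      rw [← integral_const_mul]; congr 1; funext v; ring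
    rw [c, this, Finset.mul_sum]
    refine Finset.sum_congr rfl fun i _ => ?_
    rw [integral_const_mul, integral_mul_const]; ring
  simp only [e3]
  rw [integral_finsetSum]
  · refine Finset.sum_congr rfl fun i _ => ?_
    rw [integral_const_mul, e2, integral_prod _ (i2 i j)]; ring
  · intro i _
    exact (i2 i j).integral_prod_left.const_mul _

lemma psi_zero (F G : EE ι → ℝ) : psi μ F G 0 = ∫ x, F x * G x ∂μ := by
  have := integral_prod_mul (μ := μ) (ν := μ) (fun x => F x * G x) (fun _ => 1)
  simp only [mul_one, integral_const, probReal_univ, smul_eq_mul] at this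
  simpa [psi] using this

lemma psi_pi (F G : EE ι → ℝ) : psi μ F G (π / 2) = (∫ x, F x ∂μ) * ∫ x, G x ∂μ := by
  simpa [psi] using integral_prod_mul (μ := μ) (ν := μ) F G
end interp2


section hcreal

lemma lp_bound {Ω : Type*} [MeasurableSpace Ω] (μ : Measure Ω) (q g : Ω → ℝ≥0∞) (hq : Measurable q)
    (hg : Measurable g) (q1 : ∀ x, q x ≤ 1) (p : ℝ) (p1 : 1 ≤ p) (p2 : p < 2) :
    (∫⁻ x, (q x * g x) ^ p ∂μ) ^ (1 / p) ≤
      (∫⁻ x, q x * g x ^ 2 ∂μ) ^ (1 / 2 : ℝ) * (∫⁻ x, q x ∂μ) ^ ((2 - p) / (2 * p)) := by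
  have hp0 : 0 < p := by linarith
  have hp2 : 0 < 2 - p := by linarith
  have conj : (2 / p).HolderConjugate (2 / (2 - p)) := by
    rw [Real.holderConjugate_iff]
    refine ⟨by rw [lt_div_iff₀ hp0]; linarith, ?_⟩
    field_simp; ring
  have H := ENNReal.lintegral_mul_le_Lp_mul_Lq μ conj
    (f := fun x => (q x * g x ^ 2) ^ (p / 2)) (g := fun x => q x ^ (p / 2))
    (by fun_prop) (by fun_prop)
  have e1 : ∀ x, (q x * g x) ^ p = ((q x * g x ^ 2) ^ (p / 2)) * q x ^ (p / 2) := by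
    intro x
    rw [ENNReal.mul_rpow_of_nonneg _ _ hp0.le, ENNReal.mul_rpow_of_nonneg _ _ (by positivity),
      ← ENNReal.rpow_natCast, ← ENNReal.rpow_mul, mul_right_comm,
      ← ENNReal.rpow_add_of_nonneg _ _ (by positivity) (by positivity)]
    congr 2 <;> (push_cast; ring)
  simp only [Pi.mul_apply] at H
  have e2 : ∀ x, ((q x * g x ^ 2) ^ (p / 2)) ^ (2 / p) = q x * g x ^ 2 := by
    intro x
    rw [← ENNReal.rpow_mul, show p / 2 * (2 / p) = 1 by field_simp, ENNReal.rpow_one]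
  have e3 : ∀ x, (q x ^ (p / 2)) ^ (2 / (2 - p)) ≤ q x := by
    intro x
    rw [← ENNReal.rpow_mul]
    conv_rhs => rw [← ENNReal.rpow_one (q x)]
    apply ENNReal.rpow_le_rpow_of_exponent_ge (q1 x)
    rw [div_mul_div_comm, le_div_iff₀ (by positivity)]; nlinarith
  simp only [e2, ← e1] at H
  have H2 : ∫⁻ x, (q x * g x) ^ p ∂μ ≤ (∫⁻ x, q x * g x ^ 2 ∂μ) ^ (p / 2) * (∫⁻ x, q x ∂μ) ^ ((2 - p) / 2) := by
    refine H.trans ?_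
    rw [one_div_div, one_div_div]
    gcongr with x
    exact e3 x
  refine (ENNReal.rpow_le_rpow H2 (by positivity : 0 ≤ 1 / p)).trans (le_of_eq ?_)
  rw [ENNReal.mul_rpow_of_nonneg _ _ (by positivity), ← ENNReal.rpow_mul, ← ENNReal.rpow_mul]
  congr 2 <;> field_simp

variable {ι : Type*} [Fintype ι] {κ : Type*} [Fintype κ] (μ : Measure (EE ι)) [IsGaussian μ]

lemma EG.lint {F : EE ι → ℝ} (h : EG F) (h0 : ∀ x, 0 ≤ F x) :
    ∫⁻ x, ENNReal.ofReal (F x) ∂μ = ENNReal.ofReal (∫ x, F x ∂μ) := by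
  rw [ofReal_integral_eq_lintegral_ofReal (h.int μ) (Filter.Eventually.of_forall h0)]

lemma hc_real (h0 : μ[id] = 0) (b : κ → EE ι)
    (hb : ∀ ξ, charFun μ ξ = (exp (-(∑ k, (inner ℝ (b k) ξ) ^ 2) / 2) : ℝ)) (α : ℝ)
    (hα : 0 ≤ cos α) (hα1 : cos α < 1) {q1 q2 g : EE ι → ℝ} (e1 : EG q1) (e2 : EG q2) (eg : EG g)
    (b1 : ∀ x, 0 ≤ q1 x ∧ q1 x ≤ 1) (b2 : ∀ x, 0 ≤ q2 x ∧ q2 x ≤ 1) (bg : ∀ x, 0 ≤ g x)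
    {τ : ℝ} (τ0 : 0 < τ) (τ1 : τ ≤ 1) (m1 : ∫ x, q1 x ∂μ ≤ τ) (m2 : ∫ x, q2 x ∂μ ≤ τ) :
    psi μ (fun x => q1 x * g x) (fun x => q2 x * g x) α ≤
      exp (-(log (1 / τ) / 2) * (1 - cos α)) *
        ((∫ x, q1 x * g x ^ 2 ∂μ + ∫ x, q2 x * g x ^ 2 ∂μ) / 2) := by
  have c1 := e1.cont
  have c2 := e2.cont
  have cg := eg.cont
  have hp : 0 < 1 + cos α := by linarith
  have H := gauss_HC μ h0 b hb α hα (fun x => (q1 x * g x).toNNReal) (fun x => (q2 x * g x).toNNReal)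
    (by fun_prop) (by fun_prop)
  have key : ∀ q : EE ι → ℝ, EG q → (∀ x, 0 ≤ q x ∧ q x ≤ 1) → ∫ x, q x ∂μ ≤ τ →
      (∫⁻ x, (((q x * g x).toNNReal : ℝ≥0) : ℝ≥0∞) ^ (1 + cos α) ∂μ) ^ (1 / (1 + cos α)) ≤
      ENNReal.ofReal ((∫ x, q x * g x ^ 2 ∂μ) ^ (1 / 2 : ℝ) * τ ^ ((1 - cos α) / 4)) := by
    intro q eq bq mq
    have cq := eq.cont
    have := lp_bound μ (fun x => ENNReal.ofReal (q x)) (fun x => ENNReal.ofReal (g x)) (by fun_prop)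
      (by fun_prop) (fun x => by simpa using (bq x).2) (1 + cos α) (by linarith) (by linarith)
    have s1 : ∀ x, ((((q x * g x).toNNReal : ℝ≥0) : ℝ≥0∞)) = ENNReal.ofReal (q x) * ENNReal.ofReal (g x) := by
      intro x
      rw [← ENNReal.ofReal_mul (bq x).1]; rfl
    have s2 : ∀ x, ENNReal.ofReal (q x) * ENNReal.ofReal (g x) ^ 2 = ENNReal.ofReal (q x * g x ^ 2) := by
      intro x
      rw [ENNReal.ofReal_mul (bq x).1, ENNReal.ofReal_pow (bg x)]
    have eqg : EG (fun x => q x * g x ^ 2) := by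
      have := eq.mul (eg.mul eg)
      simpa [EG, pow_two] using this
    simp only [s1]
    refine this.trans ?_
    simp only [s2]
    have nn : 0 ≤ ∫ x, q x * g x ^ 2 ∂μ := integral_nonneg fun x => mul_nonneg (bq x).1 (by positivity)
    rw [EG.lint μ eqg (fun x => mul_nonneg (bq x).1 (by positivity)), EG.lint μ eq (fun x => (bq x).1),
      ENNReal.ofReal_mul (by positivity), ENNReal.ofReal_rpow_of_nonneg nn (by norm_num)]
    gcongr
    have n0 : 0 ≤ ∫ x, q x ∂μ := integral_nonneg fun x => (bq x).1
    have hex : 0 ≤ (2 - (1 + cos α)) / (2 * (1 + cos α)) := by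
      apply div_nonneg <;> linarith
    rw [ENNReal.ofReal_rpow_of_nonneg n0 hex]
    apply ENNReal.ofReal_le_ofReal
    calc (∫ x, q x ∂μ) ^ ((2 - (1 + cos α)) / (2 * (1 + cos α)))
        ≤ τ ^ ((2 - (1 + cos α)) / (2 * (1 + cos α))) := by gcongr
      _ ≤ _ := by
        apply rpow_le_rpow_of_exponent_ge τ0 τ1
        rw [div_le_div_iff₀ (by norm_num) (by positivity)]
        nlinarith [cos_le_one α]
  have H2 := H.trans (mul_le_mul' (key q1 e1 b1 m1) (key q2 e2 b2 m2))
  set A := ∫ x, q1 x * g x ^ 2 ∂μ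
  set B := ∫ x, q2 x * g x ^ 2 ∂μ
  have hA : 0 ≤ A := integral_nonneg fun x => mul_nonneg (b1 x).1 (by positivity)
  have hB : 0 ≤ B := integral_nonneg fun x => mul_nonneg (b2 x).1 (by positivity)
  rw [← ENNReal.ofReal_mul (by positivity)] at H2
  have s3 : ∀ p : EE ι × EE ι, ((((q1 p.1 * g p.1).toNNReal : ℝ≥0) : ℝ≥0∞)) *
      (((q2 (cos α • p.1 + sin α • p.2) * g (cos α • p.1 + sin α • p.2)).toNNReal : ℝ≥0) : ℝ≥0∞)
      = ENNReal.ofReal (q1 p.1 * g p.1 * (q2 (cos α • p.1 + sin α • p.2) * g (cos α • p.1 + sin α • p.2))) := by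
    intro p
    rw [ENNReal.ofReal_mul (mul_nonneg (b1 _).1 (bg _))]; rfl
  simp only [s3] at H2
  have pn : ∀ p : EE ι × EE ι, 0 ≤ q1 p.1 * g p.1 * (q2 (cos α • p.1 + sin α • p.2) * g (cos α • p.1 + sin α • p.2)) :=
    fun p => mul_nonneg (mul_nonneg (b1 _).1 (bg _)) (mul_nonneg (b2 _).1 (bg _))
  have e : psi μ (fun x => q1 x * g x) (fun x => q2 x * g x) α ≤
     A ^ (1 / 2 : ℝ) * τ ^ ((1 - cos α) / 4) * (B ^ (1 / 2 : ℝ) * τ ^ ((1 - cos α) / 4)) := by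
    rw [psi, integral_eq_lintegral_of_nonneg_ae (Filter.Eventually.of_forall pn) (by fun_prop)]
    exact ENNReal.toReal_le_of_le_ofReal (by positivity) H2
  refine e.trans ?_
  have t : τ ^ ((1 - cos α) / 4) * τ ^ ((1 - cos α) / 4) = exp (-(log (1 / τ) / 2) * (1 - cos α)) := by
    rw [← rpow_add τ0, rpow_def_of_pos τ0, one_div, log_inv]; congr 1; ring
  rw [← sqrt_eq_rpow, ← sqrt_eq_rpow, ← t]
  have : √A * √B ≤ (A + B) / 2 := by
    nlinarith [sq_nonneg (√A - √B), sq_sqrt hA, sq_sqrt hB]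
  calc _ = τ ^ ((1 - cos α) / 4) * τ ^ ((1 - cos α) / 4) * (√A * √B) := by ring
    _ ≤ _ := by gcongr
end hcreal


section varb
variable {ι : Type*} [Fintype ι] {κ : Type*} [Fintype κ] (μ : Measure (EE ι)) [IsGaussian μ]

lemma fstEG {H : EE ι → ℝ} (hH : EG H) : EG (fun p : EE ι × EE ι => H p.1) :=
    hH.comp (fun _ => ()) (S := Unit) (V := EE ι × EE ι) (L := fun _ p => p.1) (A := 0) (B := 1)
      (fun _ => continuous_fst) (fun _ p => by simpa using norm_fst_le p)

lemma rotEG {H : EE ι → ℝ} (hH : EG H) (α : ℝ) :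
    EG (fun p : EE ι × EE ι => H (cos α • p.1 + sin α • p.2)) :=
  UG.at (T := ℝ) (hH.comp (fun _ => ()) (fun α => by fun_prop) rot_bound) α

lemma psi_int {F G : EE ι → ℝ} (hF : EG F) (hG : EG G) (α : ℝ) :
    Integrable (fun p : EE ι × EE ι => F p.1 * G (cos α • p.1 + sin α • p.2)) (μ.prod μ) :=
  ((fstEG hF).mul (rotEG hG α)).at () |>.int _

lemma psi_nonneg {F G : EE ι → ℝ} (hF : ∀ x, 0 ≤ F x) (hG : ∀ x, 0 ≤ G x) (α : ℝ) : 0 ≤ psi μ F G α :=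
  integral_nonneg fun _ => mul_nonneg (hF _) (hG _)

lemma psi_sum {A B : Type*} (s : Finset A) (t : Finset B) {F : A → EE ι → ℝ} {G : B → EE ι → ℝ}
    (hF : ∀ a, EG (F a)) (hG : ∀ a, EG (G a)) (α : ℝ) :
    ∑ a ∈ s, ∑ b ∈ t, psi μ (F a) (G b) α = psi μ (fun x => ∑ a ∈ s, F a x) (fun x => ∑ b ∈ t, G b x) α := by
  simp only [psi, Finset.sum_mul_sum]
  rw [integral_finsetSum _ fun a _ => integrable_finsetSum _ fun b _ => psi_int μ (hF a) (hG b) α]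
  refine Finset.sum_congr rfl fun a _ => ?_
  rw [integral_finsetSum _ fun b _ => psi_int μ (hF a) (hG b) α]

lemma int_fst {H : EE ι → ℝ} : ∫ p : EE ι × EE ι, H p.1 ∂(μ.prod μ) = ∫ x, H x ∂μ := by
  have := integral_prod_mul (μ := μ) (ν := μ) H (fun _ => 1)
  simpa using this

lemma int_rot1 (h0 : μ[id] = 0) {H : EE ι → ℝ} (hH : EG H) (α : ℝ) :
    ∫ p : EE ι × EE ι, H (cos α • p.1 + sin α • p.2) ∂(μ.prod μ) = ∫ x, H x ∂μ := by
  have c := hH.cont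
  have := int_rot μ h0 α (fun p => H p.1) (by fun_prop)
  rw [← int_fst μ, ← this]

lemma EG.sq {g : EE ι → ℝ} (hg : EG g) : EG (fun x => g x ^ 2) := by
  simpa [EG, pow_two] using hg.mul hg

lemma psi_self (h0 : μ[id] = 0) {g : EE ι → ℝ} (hg : EG g) (α : ℝ) : psi μ g g α ≤ ∫ x, g x ^ 2 ∂μ := by
  have i1 := (fstEG hg.sq).int (μ.prod μ)
  have i2 := (rotEG hg.sq α).int (μ.prod μ)
  calc psi μ g g α ≤ ∫ p : EE ι × EE ι, (g p.1 ^ 2 + g (cos α • p.1 + sin α • p.2) ^ 2) / 2 ∂(μ.prod μ) := by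
        refine integral_mono (psi_int μ hg hg α) ((i1.add i2).div_const 2) fun p => ?_
        simp only
        nlinarith [sq_nonneg (g p.1 - g (cos α • p.1 + sin α • p.2))]
    _ = _ := by
        rw [integral_div, integral_add i1 i2, int_rot1 μ h0 hg.sq, int_fst μ (H := fun x => g x ^ 2)]
        ring

lemma nb_sum {W : Type*} [Fintype W] (nb : W → W → Prop) [DecidableRel nb]
    (nbs : ∀ v v', nb v v' → nb v' v) (R : ℕ) (hR : ∀ v, (Finset.univ.filter (nb v)).card ≤ R)
    (S : W → ℝ) (hS : ∀ v, 0 ≤ S v) :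
    ∑ v, ∑ v', (if nb v v' then (S v + S v') / 2 else 0) ≤ R * ∑ v, S v := by
  have h1 : ∑ v, ∑ v', (if nb v v' then S v else 0) ≤ R * ∑ v, S v := by
    rw [Finset.mul_sum]
    refine Finset.sum_le_sum fun v _ => ?_
    rw [← Finset.sum_filter, Finset.sum_const, nsmul_eq_mul]
    gcongr
    · exact hS v
    · exact hR v
  have h2 : ∑ v, ∑ v', (if nb v v' then S v' else 0) = ∑ v, ∑ v', (if nb v v' then S v else 0) := by
    rw [Finset.sum_comm]
    refine Finset.sum_congr rfl fun v _ => Finset.sum_congr rfl fun v' _ => ?_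
    have : nb v' v ↔ nb v v' := ⟨nbs _ _, nbs _ _⟩
    simp [this]
  calc _ = (∑ v, ∑ v', (if nb v v' then S v else 0) + ∑ v, ∑ v', (if nb v v' then S v' else 0)) / 2 := by
        rw [← Finset.sum_add_distrib, Finset.sum_div]
        refine Finset.sum_congr rfl fun v _ => ?_
        rw [← Finset.sum_add_distrib, Finset.sum_div]
        refine Finset.sum_congr rfl fun v' _ => ?_
        split_ifs <;> simp
    _ ≤ _ := by rw [h2]; linarith

lemma var_bound (h0 : μ[id] = 0) (b : κ → EE ι)
    (hb : ∀ ξ, charFun μ ξ = (exp (-(∑ k, (inner ℝ (b k) ξ) ^ 2) / 2) : ℝ))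
    {F g : EE ι → ℝ} {p : ι → EE ι → ℝ} (hF : C1E F (fun i x => p i x * g x))
    (hp : ∀ i, EG (p i)) (hg : EG g) (p0 : ∀ i x, 0 ≤ p i x) (ps : ∀ x, ∑ i, p i x = 1)
    (g0 : ∀ x, 0 ≤ g x) {W : Type*} [Fintype W] [DecidableEq W] (w : ι → W) (nb : W → W → Prop)
    [DecidableRel nb] (nbs : ∀ v v', nb v v' → nb v' v) (R : ℕ)
    (hR : ∀ v, (Finset.univ.filter (nb v)).card ≤ R) (c1 : ∀ i j, cv μ i j ≤ 1) {K : ℝ} (K0 : 0 ≤ K)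
    (cK : ∀ i j, ¬ nb (w i) (w j) → cv μ i j ≤ K) {τ : ℝ} (τ0 : 0 < τ) (τ1 : τ < 1)
    (hτ : ∀ v, ∫ x, ∑ i with w i = v, p i x ∂μ ≤ τ) :
    ∫ x, F x * F x ∂μ - (∫ x, F x ∂μ) * (∫ x, F x ∂μ) ≤ (K + R / (log (1 / τ) / 2)) * ∫ x, g x ^ 2 ∂μ := by
  set lam := log (1 / τ) / 2 with hlam
  have lam0 : 0 < lam := by
    have : 0 < log (1 / τ) := log_pos (by rw [lt_div_iff₀ τ0]; linarith)
    positivity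
  set Q := ∫ x, g x ^ 2 ∂μ with hQ
  have Q0 : 0 ≤ Q := integral_nonneg fun x => by positivity
  have hpg : ∀ i, EG (fun x => p i x * g x) := fun i => (hp i).mul hg
  set q : W → EE ι → ℝ := fun v x => ∑ i with w i = v, p i x with hq
  have eq : ∀ v, EG (q v) := fun v => UG.sum _ hp
  have sq : ∀ x, ∑ v, q v x = 1 := by
    intro x; simp only [hq]; rw [Finset.sum_fiberwise]; exact ps x
  have bq : ∀ v x, 0 ≤ q v x ∧ q v x ≤ 1 := by
    intro v x
    refine ⟨Finset.sum_nonneg fun i _ => p0 i x, ?_⟩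
    rw [← ps x]
    exact Finset.sum_le_sum_of_subset_of_nonneg (Finset.filter_subset _ _) fun i _ _ => p0 i x
  have main : ∀ α : ℝ, 0 ≤ cos α → cos α < 1 →
      ∑ i, ∑ j, cv μ i j * psi μ (fun x => p i x * g x) (fun x => p j x * g x) α ≤
        Q * (K + R * exp (-lam * (1 - cos α))) := by
    intro α a0 a1
    set P : ι → ι → ℝ := fun i j => psi μ (fun x => p i x * g x) (fun x => p j x * g x) α with hP
    have P0 : ∀ i j, 0 ≤ P i j := fun i j => psi_nonneg μ (fun x => mul_nonneg (p0 i x) (g0 x))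
      (fun x => mul_nonneg (p0 j x) (g0 x)) α
    have s1 : ∑ i, ∑ j, cv μ i j * P i j ≤ K * ∑ i, ∑ j, P i j +
        ∑ i, ∑ j, (if nb (w i) (w j) then P i j else 0) := by
      rw [Finset.mul_sum, ← Finset.sum_add_distrib]
      refine Finset.sum_le_sum fun i _ => ?_
      rw [Finset.mul_sum, ← Finset.sum_add_distrib]
      refine Finset.sum_le_sum fun j _ => ?_
      have := P0 i j
      split_ifs with h
      · have := c1 i j
        have : 0 ≤ K * P i j := by positivity
        nlinarith
      · rw [add_zero]; exact mul_le_mul_of_nonneg_right (cK i j h) (P0 i j)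
    have s2 : ∑ i, ∑ j, P i j ≤ Q := by
      rw [hP, psi_sum μ _ _ hpg hpg]
      simp only [← Finset.sum_mul, ps, one_mul]
      exact psi_self μ h0 hg α
    have s3 : ∑ i, ∑ j, (if nb (w i) (w j) then P i j else 0) =
        ∑ v, ∑ v', (if nb v v' then psi μ (fun x => q v x * g x) (fun x => q v' x * g x) α else 0) := by
      rw [← Finset.sum_fiberwise (s := Finset.univ) (g := w)]
      refine Finset.sum_congr rfl fun v _ => ?_
      have : ∀ i, ∑ j, (if nb (w i) (w j) then P i j else 0) =
          ∑ v', ∑ j with w j = v', (if nb (w i) (w j) then P i j else 0) := fun i =>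
        (Finset.sum_fiberwise _ _ _).symm
      simp only [this]
      rw [Finset.sum_comm]
      refine Finset.sum_congr rfl fun v' _ => ?_
      simp only [hq, Finset.sum_mul]
      rw [← psi_sum μ _ _ hpg hpg]
      by_cases h : nb v v'
      · rw [if_pos h]
        refine Finset.sum_congr rfl fun i hi => Finset.sum_congr rfl fun j hj => ?_
        rw [Finset.mem_filter] at hi hj
        rw [hi.2, hj.2, if_pos h]
      · rw [if_neg h]
        refine Finset.sum_eq_zero fun i hi => Finset.sum_eq_zero fun j hj => ?_
        rw [Finset.mem_filter] at hi hj
        rw [hi.2, hj.2, if_neg h]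
    set S : W → ℝ := fun v => ∫ x, q v x * g x ^ 2 ∂μ with hS
    have S0 : ∀ v, 0 ≤ S v := fun v => integral_nonneg fun x => mul_nonneg (bq v x).1 (by positivity)
    have sS : ∑ v, S v = Q := by
      rw [hS, ← integral_finsetSum _ fun v _ => (((eq v).mul hg.sq).at ()).int μ]
      simp only [← Finset.sum_mul, sq, one_mul, hQ]
    have s4 : ∑ v, ∑ v', (if nb v v' then psi μ (fun x => q v x * g x) (fun x => q v' x * g x) α else 0)
        ≤ exp (-lam * (1 - cos α)) * ∑ v, ∑ v', (if nb v v' then (S v + S v') / 2 else 0) := by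
      rw [Finset.mul_sum]
      refine Finset.sum_le_sum fun v _ => ?_
      rw [Finset.mul_sum]
      refine Finset.sum_le_sum fun v' _ => ?_
      split_ifs
      · exact hc_real μ h0 b hb α a0 a1 (eq v) (eq v') hg (bq v) (bq v') g0 τ0 τ1.le (hτ v) (hτ v')
      · simp
    have s5 := nb_sum nb nbs R hR S S0
    rw [sS] at s5
    have ex : 0 < exp (-lam * (1 - cos α)) := exp_pos _
    calc _ ≤ K * Q + exp (-lam * (1 - cos α)) * (R * Q) := by
          refine s1.trans ?_
          rw [s3]
          refine add_le_add (by gcongr) (s4.trans (by gcongr))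
      _ = _ := by ring
  -- monotonicity
  set H : ℝ → ℝ := fun α => -K * cos α - R / lam * exp (-lam * (1 - cos α)) with hH
  have dH : ∀ α, HasDerivAt H (sin α * (K + R * exp (-lam * (1 - cos α)))) α := by
    intro α
    have d1 : HasDerivAt (fun α => -lam * (1 - cos α)) (-lam * sin α) α := by
      have := ((hasDerivAt_cos α).const_sub 1).const_mul (-lam)
      simpa using this
    have := ((hasDerivAt_cos α).const_mul (-K)).sub (d1.exp.const_mul (R / lam))
    convert! this using 1
    field_simp; ring
  have dG : ∀ α, HasDerivAt (fun α => psi μ F F α + Q * H α)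
      (-sin α * ∑ i, ∑ j, cv μ i j * psi μ (fun x => p i x * g x) (fun x => p j x * g x) α
        + Q * (sin α * (K + R * exp (-lam * (1 - cos α))))) α := fun α =>
    (psi_deriv μ h0 hF hF α).add ((dH α).const_mul Q)
  have mono : MonotoneOn (fun α => psi μ F F α + Q * H α) (Set.Icc 0 (π / 2)) := by
    refine monotoneOn_of_deriv_nonneg (convex_Icc _ _)
      (fun x _ => (dG x).continuousAt.continuousWithinAt)
      (fun x _ => (dG x).differentiableAt.differentiableWithinAt) fun x hx => ?_
    rw [interior_Icc] at hx
    rw [(dG x).deriv]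
    have hs : 0 ≤ sin x := sin_nonneg_of_nonneg_of_le_pi hx.1.le (by linarith [hx.2, pi_pos])
    have hc : 0 ≤ cos x := cos_nonneg_of_mem_Icc ⟨by linarith [hx.1, pi_pos], hx.2.le⟩
    have hc1 : cos x < 1 := by
      have := cos_lt_cos_of_nonneg_of_le_pi_div_two le_rfl hx.2.le hx.1
      rwa [cos_zero] at this
    have := mul_le_mul_of_nonneg_left (main x hc hc1) hs
    linarith
  have fin := mono (Set.left_mem_Icc.2 (by positivity)) (Set.right_mem_Icc.2 (by positivity))
    (by positivity : (0:ℝ) ≤ π / 2)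
  simp only [psi_zero, psi_pi, hH, cos_zero, cos_pi_div_two, sub_self, mul_zero, exp_zero, sub_zero,
    mul_one] at fin
  have : 0 ≤ R / lam * exp (-lam) * Q := by positivity
  linarith
end varb


section softmax
variable {ι : Type*} [Fintype ι] [Nonempty ι]

noncomputable def mx (x : EE ι) : ℝ := ⨆ i, x i

lemma le_mx (x : EE ι) (i : ι) : x i ≤ mx x := le_ciSup (f := fun i => x i) (Set.finite_range _).bddAbove i

lemma mx_le {x : EE ι} {a : ℝ} (h : ∀ i, x i ≤ a) : mx x ≤ a := ciSup_le h

lemma exists_mx (x : EE ι) : ∃ i, x i = mx x := exists_eq_ciSup_of_finite (f := fun i => x i)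

lemma mx_abs (x : EE ι) : |mx x| ≤ ‖x‖ := by
  obtain ⟨i, hi⟩ := exists_mx x
  rw [← hi]; exact coord_le x i

lemma mx_lip (x y : EE ι) : mx x ≤ mx y + ‖x - y‖ := by
  refine mx_le fun i => ?_
  have h1 := le_mx y i
  have h2 := (le_abs_self _).trans (coord_le (x - y) i)
  simp only [PiLp.sub_apply] at h2
  linarith

lemma mx_cont : Continuous (mx : EE ι → ℝ) := by
  refine (LipschitzWith.of_le_add_mul 1 fun x y => ?_).continuous
  simpa [dist_eq_norm] using mx_lip x y

lemma linEG {F : EE ι → ℝ} (hc : Continuous F) {a : ℝ} (h : ∀ x, |F x| ≤ a + ‖x‖) : EG F := by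
  refine ⟨fun _ => hc, |a| + 1, 1, by positivity, zero_le_one, fun _ x => ?_⟩
  have h1 := add_one_le_exp (1 * ‖x‖)
  have h2 : 1 ≤ exp (1 * ‖x‖) := one_le_exp (by positivity)
  have h3 := h x
  nlinarith [le_abs_self a, abs_nonneg a]

lemma expEG {F : EE ι → ℝ} (hc : Continuous F) {a : ℝ} (h : ∀ x, |F x| ≤ a + ‖x‖) (θ : ℝ) :
    EG (fun x => exp (θ * F x)) := by
  refine ⟨fun _ => by fun_prop, exp (|θ| * a), |θ|, by positivity, by positivity, fun _ x => ?_⟩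
  rw [abs_of_pos (exp_pos _), ← exp_add, ← mul_add]
  apply exp_le_exp.2
  calc θ * F x ≤ |θ| * |F x| := by rw [← abs_mul]; exact le_abs_self _
    _ ≤ _ := by gcongr; exact h x

lemma cEG (s : ℝ) : EG (fun _ : EE ι => s) := UG.bdd (T := Unit) (K := |s|) (c := fun _ => s) (fun _ => le_rfl)

lemma C1E.expc {F : EE ι → ℝ} {F' : ι → EE ι → ℝ} (hF : C1E F F') {a : ℝ} (h : ∀ x, |F x| ≤ a + ‖x‖)
    (s θ : ℝ) : C1E (fun x => s * exp (θ * F x)) (fun i x => F' i x * (s * θ * exp (θ * F x))) := by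
  have hc := hF.eg.cont
  refine ⟨fun x => ?_, (cEG s).mul (expEG hc h θ), fun j => (hF.eg' j).mul ((cEG (s * θ)).mul (expEG hc h θ))⟩
  have h1 := (((hF.deriv x).const_mul θ).exp).const_mul s
  convert! h1 using 1
  simp only [Finset.smul_sum, smul_smul]
  refine Finset.sum_congr rfl fun i _ => ?_
  congr 1; ring

noncomputable def ss (β : ℝ) (x : EE ι) : ℝ := ∑ i, exp (β * x i)
noncomputable def sm (β : ℝ) (x : EE ι) : ℝ := log (ss β x) / β
noncomputable def pm (β : ℝ) (i : ι) (x : EE ι) : ℝ := exp (β * x i) / ss β x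

lemma ss_pos (β : ℝ) (x : EE ι) : 0 < ss β x :=
  Finset.sum_pos (fun i _ => exp_pos _) Finset.univ_nonempty

lemma pm_nonneg (β : ℝ) (i : ι) (x : EE ι) : 0 ≤ pm β i x := div_nonneg (exp_pos _).le (ss_pos β x).le

lemma pm_sum (β : ℝ) (x : EE ι) : ∑ i, pm β i x = 1 := by
  unfold pm
  rw [← Finset.sum_div]
  exact div_self (ss_pos β x).ne'

lemma pm_le (β : ℝ) (i : ι) (x : EE ι) : pm β i x ≤ 1 := by
  rw [← pm_sum β x]
  exact Finset.single_le_sum (f := fun i => pm β i x) (fun i _ => pm_nonneg β i x) (Finset.mem_univ i)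

lemma ss_cont (β : ℝ) : Continuous (ss β : EE ι → ℝ) := by unfold ss; fun_prop

lemma pm_EG (β : ℝ) (i : ι) : EG (pm β i : EE ι → ℝ) := by
  refine ⟨fun _ => ?_, 1, 0, zero_le_one, le_rfl, fun _ x => ?_⟩
  · unfold pm
    exact (by fun_prop : Continuous fun x : EE ι => exp (β * x i)).div (ss_cont β) (fun x => (ss_pos β x).ne')
  · rw [abs_of_nonneg (pm_nonneg β i x)]; simpa using pm_le β i x

lemma mx_le_sm {β : ℝ} (hβ : 0 < β) (x : EE ι) : mx x ≤ sm β x := by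
  obtain ⟨i, hi⟩ := exists_mx x
  rw [sm, le_div_iff₀ hβ, le_log_iff_exp_le (ss_pos β x), ← hi, mul_comm]
  exact Finset.single_le_sum (f := fun i => exp (β * x i)) (fun i _ => (exp_pos _).le) (Finset.mem_univ i)

lemma sm_le {β : ℝ} (hβ : 0 < β) (x : EE ι) : sm β x ≤ mx x + log (Fintype.card ι) / β := by
  have hn : (0 : ℝ) < Fintype.card ι := by exact_mod_cast Fintype.card_pos
  have : ss β x ≤ Fintype.card ι * exp (β * mx x) := by
    unfold ss
    calc _ ≤ ∑ i : ι, exp (β * mx x) := Finset.sum_le_sum fun i _ => by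
          gcongr; exact le_mx x i
      _ = _ := by simp
  have h2 := log_le_log (ss_pos β x) this
  rw [log_mul hn.ne' (exp_pos _).ne', log_exp] at h2
  rw [sm, div_le_iff₀ hβ, add_mul, div_mul_cancel₀ _ hβ.ne']
  linarith

lemma logcard_nonneg : 0 ≤ log (Fintype.card ι) := log_natCast_nonneg _

lemma sm_abs {β : ℝ} (hβ : 0 < β) (x : EE ι) : |sm β x| ≤ log (Fintype.card ι) / β + ‖x‖ := by
  have h1 := mx_le_sm hβ x
  have h2 := sm_le hβ x
  have h3 := abs_le.1 (mx_abs x)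
  have : 0 ≤ log (Fintype.card ι) / β := div_nonneg logcard_nonneg hβ.le
  rw [abs_le]; constructor <;> linarith

lemma sm_C1E {β : ℝ} (hβ : 0 < β) : C1E (sm β : EE ι → ℝ) (pm β) := by
  have hd : ∀ x : EE ι, HasFDerivAt (sm β) (∑ j, pm β j x • (EuclideanSpace.proj j : EE ι →L[ℝ] ℝ)) x := by
    intro x
    have h1 : HasFDerivAt (ss β : EE ι → ℝ) (∑ i : ι, exp (β * x i) • (β • (EuclideanSpace.proj i : EE ι →L[ℝ] ℝ))) x := by
      unfold ss
      refine HasFDerivAt.fun_sum fun i _ => ?_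
      exact (((EuclideanSpace.proj i : EE ι →L[ℝ] ℝ).hasFDerivAt (x := x)).const_mul β).exp
    have h2 := (h1.log (ss_pos β x).ne').mul_const β⁻¹
    convert! h2 using 1
    simp only [Finset.smul_sum, smul_smul]
    refine Finset.sum_congr rfl fun i _ => ?_
    congr 1
    have := (ss_pos β x).ne'
    unfold pm; field_simp
  refine ⟨hd, ?_, pm_EG β⟩
  exact linEG (continuous_iff_continuousAt.2 fun x => (hd x).continuousAt) (sm_abs hβ)
end softmax


section herbst
variable {ι : Type*} [Fintype ι] [Nonempty ι] (μ : Measure (EE ι)) [IsGaussian μ]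

lemma cov_exp (h0 : μ[id] = 0) {f : EE ι → ℝ} {p : ι → EE ι → ℝ} (hf : C1E f p)
    (p0 : ∀ i x, 0 ≤ p i x) (ps : ∀ x, ∑ i, p i x = 1) (c1 : ∀ i j, cv μ i j ≤ 1)
    {a : ℝ} (ha : ∀ x, |f x| ≤ a + ‖x‖) (θ : ℝ) :
    0 ≤ θ * (θ * ∫ x, exp (θ * f x) ∂μ -
      (∫ x, f x * exp (θ * f x) ∂μ - (∫ x, f x ∂μ) * ∫ x, exp (θ * f x) ∂μ)) := by
  set G : EE ι → ℝ := fun x => exp (θ * f x) with hG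
  have eG : EG G := expEG hf.eg.cont ha θ
  have k : C1E G (fun i x => p i x * (θ * G x)) := by
    have := hf.expc ha 1 θ
    simpa using this
  set L := ∫ x, G x ∂μ with hL
  have main : ∀ α, θ * (∑ i, ∑ j, cv μ i j * psi μ (p i) (fun x => p j x * (θ * G x)) α) ≤ θ ^ 2 * L := by
    intro α
    have e1 : ∀ i j, psi μ (p i) (fun x => p j x * (θ * G x)) α = θ * psi μ (p i) (fun x => p j x * G x) α := by
      intro i j
      simp only [psi]
      rw [← integral_const_mul]
      congr 1; ext x; ring
    simp only [e1]
    have e2 : ∑ i, ∑ j, psi μ (p i) (fun x => p j x * G x) α = L := by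
      rw [psi_sum μ _ _ hf.eg' (fun j => (hf.eg' j).mul eG)]
      simp only [← Finset.sum_mul, ps, psi, one_mul]
      exact int_rot1 μ h0 eG α
    rw [← e2, Finset.mul_sum, Finset.mul_sum]
    refine Finset.sum_le_sum fun i _ => ?_
    rw [Finset.mul_sum, Finset.mul_sum]
    refine Finset.sum_le_sum fun j _ => ?_
    have : 0 ≤ psi μ (p i) (fun x => p j x * G x) α :=
      psi_nonneg μ (p0 i) (fun x => mul_nonneg (p0 j x) (exp_pos _).le) α
    have h2 := mul_le_mul_of_nonneg_right (c1 i j) (mul_nonneg (sq_nonneg θ) this)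
    linarith
  have dG : ∀ α, HasDerivAt (fun α => θ * psi μ f G α - θ ^ 2 * L * cos α)
      (θ * (-sin α * ∑ i, ∑ j, cv μ i j * psi μ (p i) (fun x => p j x * (θ * G x)) α)
        - θ ^ 2 * L * (-sin α)) α := fun α =>
    ((psi_deriv μ h0 hf k α).const_mul θ).sub ((hasDerivAt_cos α).const_mul _)
  have mono : MonotoneOn (fun α => θ * psi μ f G α - θ ^ 2 * L * cos α) (Set.Icc 0 (π / 2)) := by
    refine monotoneOn_of_deriv_nonneg (convex_Icc _ _)
      (fun x _ => (dG x).continuousAt.continuousWithinAt)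
      (fun x _ => (dG x).differentiableAt.differentiableWithinAt) fun x hx => ?_
    rw [interior_Icc] at hx
    rw [(dG x).deriv]
    have hs : 0 ≤ sin x := sin_nonneg_of_nonneg_of_le_pi hx.1.le (by linarith [hx.2, pi_pos])
    have := mul_le_mul_of_nonneg_left (main x) hs
    linarith
  have fin := mono (Set.left_mem_Icc.2 (by positivity)) (Set.right_mem_Icc.2 (by positivity))
    (by positivity : (0:ℝ) ≤ π / 2)
  simp only [psi_zero, psi_pi, cos_zero, cos_pi_div_two, mul_zero, sub_zero, mul_one] at fin
  linarith

lemma herbst (h0 : μ[id] = 0) {f : EE ι → ℝ} {p : ι → EE ι → ℝ} (hf : C1E f p)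
    (p0 : ∀ i x, 0 ≤ p i x) (ps : ∀ x, ∑ i, p i x = 1) (c1 : ∀ i j, cv μ i j ≤ 1)
    {a : ℝ} (ha : ∀ x, |f x| ≤ a + ‖x‖) (θ : ℝ) :
    ∫ x, exp (θ * (f x - ∫ y, f y ∂μ)) ∂μ ≤ exp (θ ^ 2 / 2) := by
  set m := ∫ y, f y ∂μ with hm
  have hint : ∀ t, t ∈ interior (integrableExpSet f μ) := by
    intro t
    have : integrableExpSet f μ = Set.univ := by
      ext s; simp only [integrableExpSet, Set.mem_ofPred_eq, Set.mem_univ, iff_true]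
      exact (expEG hf.eg.cont ha s).int μ
    rw [this, interior_univ]; trivial
  set H : ℝ → ℝ := fun t => mgf f μ t * exp (-t * m - t ^ 2 / 2) with hH
  have dH : ∀ t, HasDerivAt H ((∫ x, f x * exp (t * f x) ∂μ - m * (∫ x, exp (t * f x) ∂μ) - t * ∫ x, exp (t * f x) ∂μ)
      * exp (-t * m - t ^ 2 / 2)) t := by
    intro t
    have d2 : HasDerivAt (fun t : ℝ => -t * m - t ^ 2 / 2) (-m - t) t := by
      have := ((hasDerivAt_id t).neg.mul_const m).sub ((hasDerivAt_pow 2 t).div_const 2)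
      convert! this using 1
      simp
    have := (hasDerivAt_mgf (hint t)).mul d2.exp
    convert! this using 1
    simp only [mgf]; ring
  have key := fun t => cov_exp μ h0 hf p0 ps c1 ha t
  have H1 : H θ ≤ H 0 := by
    rcases le_total 0 θ with hθ | hθ
    · have : AntitoneOn H (Set.Ici 0) := by
        refine antitoneOn_of_deriv_nonpos (convex_Ici _) (fun x _ => (dH x).continuousAt.continuousWithinAt)
          (fun x _ => (dH x).differentiableAt.differentiableWithinAt) fun x hx => ?_
        rw [interior_Ici] at hx
        rw [(dH x).deriv]
        refine mul_nonpos_of_nonpos_of_nonneg ?_ (exp_pos _).le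
        have := nonneg_of_mul_nonneg_right (key x) hx
        linarith
      exact this (Set.mem_Ici.2 le_rfl) hθ hθ
    · have : MonotoneOn H (Set.Iic 0) := by
        refine monotoneOn_of_deriv_nonneg (convex_Iic _) (fun x _ => (dH x).continuousAt.continuousWithinAt)
          (fun x _ => (dH x).differentiableAt.differentiableWithinAt) fun x hx => ?_
        rw [interior_Iic] at hx
        rw [(dH x).deriv]
        refine mul_nonneg ?_ (exp_pos _).le
        have hx' : 0 < -x := by simpa using hx
        have h3 := key x
        rw [← neg_mul_neg] at h3
        have := nonneg_of_mul_nonneg_right h3 hx'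
        linarith
      exact this hθ (Set.mem_Iic.2 le_rfl) hθ
  have e0 : H 0 = 1 := by simp [hH]
  rw [e0] at H1
  have e1 : ∫ x, exp (θ * (f x - m)) ∂μ = H θ * exp (θ ^ 2 / 2) := by
    simp only [hH, mgf]
    rw [mul_assoc, ← exp_add, ← integral_mul_const]
    congr 1; ext x
    rw [← exp_add]; congr 1; ring
  rw [e1]
  nlinarith [exp_pos (θ ^ 2 / 2)]

lemma mx_EG : EG (mx : EE ι → ℝ) := linEG (a := 0) mx_cont fun x => by simpa using mx_abs x

lemma mx_exp_int (θ m : ℝ) : Integrable (fun x : EE ι => exp (θ * (mx x - m))) μ := by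
  have := ((expEG (a := 0) mx_cont (fun x => by simpa using mx_abs x) θ).int μ).mul_const (exp (-θ * m))
  refine this.congr (ae_of_all _ fun x => ?_)
  simp only [← exp_add]; congr 1; ring

lemma sm_exp_int {β : ℝ} (hβ : 0 < β) (θ m : ℝ) : Integrable (fun x : EE ι => exp (θ * (sm β x - m))) μ := by
  have := ((expEG (sm_C1E hβ).eg.cont (sm_abs hβ) θ).int μ).mul_const (exp (-θ * m))
  refine this.congr (ae_of_all _ fun x => ?_)
  simp only [← exp_add]; congr 1; ring

lemma mx_cmp {β : ℝ} (hβ : 0 < β) (θ : ℝ) :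
    ∫ x, exp (θ * (mx x - ∫ y, mx y ∂μ)) ∂μ ≤
      exp (|θ| * (log (Fintype.card ι) / β)) * ∫ x, exp (θ * (sm β x - ∫ y, sm β y ∂μ)) ∂μ := by
  rw [← integral_const_mul]
  refine integral_mono (mx_exp_int μ _ _) ((sm_exp_int μ hβ _ _).const_mul _) fun x => ?_
  rw [← exp_add]
  apply exp_le_exp.2
  set δ := log (Fintype.card ι) / β with hδ
  have i1 : Integrable (mx : EE ι → ℝ) μ := mx_EG.int μ
  have i2 : Integrable (sm β : EE ι → ℝ) μ := (sm_C1E hβ).eg.int μ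
  have h1 : ∫ y, mx y ∂μ ≤ ∫ y, sm β y ∂μ := integral_mono i1 i2 (mx_le_sm hβ)
  have h2 : ∫ y, sm β y ∂μ ≤ ∫ y, mx y ∂μ + δ := by
    have := integral_mono i2 (i1.add (integrable_const δ)) (sm_le hβ)
    rw [integral_add' i1 (integrable_const δ)] at this
    simpa using this
  have h3 := mx_le_sm hβ x
  have h4 := sm_le hβ x
  have : |((mx x - ∫ y, mx y ∂μ) - (sm β x - ∫ y, sm β y ∂μ))| ≤ δ := by
    rw [abs_le]; constructor <;> linarith
  have h5 : θ * ((mx x - ∫ y, mx y ∂μ) - (sm β x - ∫ y, sm β y ∂μ)) ≤ |θ| * δ := by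
    refine (le_abs_self _).trans ?_
    rw [abs_mul]; gcongr
  linarith

lemma mx_herbst (h0 : μ[id] = 0) (c1 : ∀ i j, cv μ i j ≤ 1) (θ : ℝ) :
    ∫ x, exp (θ * (mx x - ∫ y, mx y ∂μ)) ∂μ ≤ exp (θ ^ 2 / 2) := by
  have h : ∀ β : ℝ, 0 < β → ∫ x, exp (θ * (mx x - ∫ y, mx y ∂μ)) ∂μ ≤
      exp (|θ| * (log (Fintype.card ι) / β)) * exp (θ ^ 2 / 2) := fun β hβ =>
    (mx_cmp μ hβ θ).trans (by
      gcongr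
      exact herbst μ h0 (sm_C1E hβ) (pm_nonneg β) (pm_sum β) c1 (sm_abs hβ) θ)
  have t : Filter.Tendsto (fun β : ℝ => exp (|θ| * (log (Fintype.card ι) / β)) * exp (θ ^ 2 / 2)) Filter.atTop
      (nhds (exp (|θ| * 0) * exp (θ ^ 2 / 2))) := by
    refine Filter.Tendsto.mul_const _ ?_
    refine (continuous_exp.tendsto _).comp ?_
    exact (Filter.Tendsto.div_atTop tendsto_const_nhds Filter.tendsto_id).const_mul _
  simp only [mul_zero, exp_zero, one_mul] at t
  exact ge_of_tendsto t (Filter.eventually_atTop.2 ⟨1, fun β hβ => h β (by linarith)⟩)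
end herbst


lemma exp_one_step {Ω : Type*} [MeasurableSpace Ω] (μ : Measure Ω) [IsProbabilityMeasure μ] (u : Ω → ℝ)
    (i1 : Integrable (fun x => exp (u x / 2)) μ) (i2 : Integrable (fun x => exp (u x)) μ)
    (i3 : Integrable (fun x => u x ^ 2) μ) (h1 : ∫ x, u x ^ 2 ∂μ ≤ 1)
    (h2 : ∫ x, exp (u x) ∂μ - (∫ x, exp (u x / 2) ∂μ) ^ 2 ≤ 1 / 4 * ∫ x, exp (u x) ∂μ) :
    ∫ x, exp (u x) ∂μ ≤ 64 := by
  set A := ∫ x, exp (u x) ∂μ with hA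
  have A0 : 0 < A := integral_exp_pos i2
  set a := √A with ha
  have a0 : 0 < a := sqrt_pos.2 A0
  have aA : a ^ 2 = A := sq_sqrt A0.le
  have pt : ∀ x, exp (u x / 2) ≤ exp 1 + (1 / (4 * a) * exp (u x) + a / 4 * u x ^ 2) := by
    intro x
    have e : exp (u x) = exp (u x / 2) ^ 2 := by rw [← exp_nat_mul]; congr 1; push_cast; ring
    set h := exp (u x / 2) with hh
    have h0 : 0 < h := exp_pos _
    rcases le_total (u x) 2 with hu | hu
    · have : h ≤ exp 1 := exp_le_exp.2 (by linarith)
      have : 0 ≤ 1 / (4 * a) * exp (u x) + a / 4 * u x ^ 2 := by positivity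
      linarith
    · have k1 : h ≤ h * u x / 2 := by nlinarith
      have k2 : h * u x / 2 ≤ 1 / (4 * a) * exp (u x) + a / 4 * u x ^ 2 := by
        rw [e]
        have : 1 / (4 * a) * h ^ 2 + a / 4 * u x ^ 2 - h * u x / 2 = (h - a * u x) ^ 2 / (4 * a) := by
          field_simp; ring
        have : 0 ≤ (h - a * u x) ^ 2 / (4 * a) := by positivity
        linarith
      linarith [exp_pos 1]
  have hm := integral_mono i1 ((integrable_const (exp 1)).add ((i2.const_mul (1 / (4 * a))).add (i3.const_mul (a / 4)))) pt
  rw [integral_add' (integrable_const _) ((i2.const_mul (1 / (4 * a))).add (i3.const_mul (a / 4))),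
    integral_add' (i2.const_mul (1 / (4 * a))) (i3.const_mul (a / 4)), integral_const_mul, integral_const_mul] at hm
  simp only [integral_const, probReal_univ, one_smul] at hm
  rw [← hA] at hm
  have k1 : 1 / (4 * a) * A = a / 4 := by rw [← aA]; field_simp
  have k2 : a / 4 * ∫ x, u x ^ 2 ∂μ ≤ a / 4 := by nlinarith
  have k3 : ∫ x, exp (u x / 2) ∂μ ≤ exp 1 + a / 2 := by linarith
  set E := ∫ x, exp (u x / 2) ∂μ with hE
  have E0 : 0 ≤ E := integral_nonneg fun x => (exp_pos _).le
  have e1 := exp_one_lt_d9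
  have : 3 / 4 * a ^ 2 ≤ (2.72 + a / 2) ^ 2 := by
    have : 3 / 4 * a ^ 2 ≤ E ^ 2 := by rw [aA]; linarith
    refine this.trans ?_
    gcongr; linarith
  have : a ≤ 8 := by nlinarith
  nlinarith

section super
variable {ι : Type*} [Fintype ι] [Nonempty ι] (μ : Measure (EE ι)) [IsGaussian μ]

lemma exists_b (h0 : μ[id] = 0) : ∃ b : ι → EE ι, ∀ ξ, charFun μ ξ = (exp (-(∑ k, (inner ℝ (b k) ξ) ^ 2) / 2) : ℝ) := by
  classical
  have hco : ∀ i j, Integrable (fun x : EE ι => x i * x j) μ := fun i j => ((coord_EG i).mul (coord_EG j)).at () |>.int μ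
  have quad : ∀ ξ : ι → ℝ, ∫ x, (∑ i, ξ i * x i) ^ 2 ∂μ = ∑ i, ∑ j, ξ i * ξ j * cv μ i j := by
    intro ξ
    have : ∀ x : EE ι, (∑ i, ξ i * x i) ^ 2 = ∑ i, ∑ j, ξ i * ξ j * (x i * x j) := by
      intro x; rw [pow_two, Finset.sum_mul_sum]
      refine Finset.sum_congr rfl fun i _ => Finset.sum_congr rfl fun j _ => by ring
    simp only [this]
    rw [integral_finsetSum _ fun i _ => integrable_finsetSum _ fun j _ => (hco i j).const_mul _]
    refine Finset.sum_congr rfl fun i _ => ?_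
    rw [integral_finsetSum _ fun j _ => (hco i j).const_mul _]
    refine Finset.sum_congr rfl fun j _ => ?_
    rw [integral_const_mul]; rfl
  have psd : (Matrix.of (cv μ)).PosSemidef := by
    refine Matrix.PosSemidef.of_dotProduct_mulVec_nonneg ?_ fun ξ => ?_
    · ext i j; simp [cv, mul_comm]
    · have : star ξ ⬝ᵥ (Matrix.of (cv μ)).mulVec ξ = ∫ x, (∑ i, ξ i * x i) ^ 2 ∂μ := by
        rw [quad]
        simp only [dotProduct, Matrix.mulVec, Finset.mul_sum, Matrix.of_apply, Pi.star_apply, star_trivial]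
        refine Finset.sum_congr rfl fun i _ => Finset.sum_congr rfl fun j _ => by ring
      rw [this]; exact integral_nonneg fun x => by positivity
  obtain ⟨B, hB⟩ : ∃ B : Matrix ι ι ℝ, Matrix.of (cv μ) = star B * B := by
    open scoped MatrixOrder in
    exact CStarAlgebra.nonneg_iff_eq_star_mul_self.1 psd.nonneg
  have hc : ∀ i j, cv μ i j = ∑ k, B k i * B k j := by
    intro i j
    have := congrFun (congrFun hB i) j
    simpa [Matrix.mul_apply] using this
  refine ⟨fun k => WithLp.toLp 2 (fun i => B k i), fun ξ => ?_⟩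
  rw [IsGaussian.charFun_eq]
  have m0 : ∫ x, inner ℝ ξ x ∂μ = 0 := by
    have h := IsGaussian.integral_dual (μ := μ) (innerSL ℝ ξ)
    simp only [id] at h0
    rw [h0] at h
    simpa using h
  have e2 : Var[fun x => inner ℝ ξ x; μ] = ∑ k, (inner ℝ (WithLp.toLp 2 (fun i => B k i) : EE ι) ξ) ^ 2 := by
    rw [variance_of_integral_eq_zero (by fun_prop) m0]
    have : ∀ x : EE ι, inner ℝ ξ x = ∑ i, ξ i * x i := fun x => by
      simp [PiLp.inner_apply, mul_comm]
    have e3 : ∀ k, inner ℝ (WithLp.toLp 2 (fun i => B k i) : EE ι) ξ = ∑ i, B k i * ξ i := fun k => by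
      simp [PiLp.inner_apply, mul_comm]
    simp only [this, e3]
    rw [quad]
    have e4 : ∀ k, (∑ i, B k i * ξ i) ^ 2 = ∑ i, ∑ j, ξ i * ξ j * (B k i * B k j) := fun k => by
      rw [pow_two, Finset.sum_mul_sum]
      exact Finset.sum_congr rfl fun i _ => Finset.sum_congr rfl fun j _ => by ring
    simp only [e4, hc, Finset.mul_sum]
    rw [Finset.sum_comm (f := fun k i => ∑ j, ξ i * ξ j * (B k i * B k j))]
    refine Finset.sum_congr rfl fun i _ => ?_
    rw [Finset.sum_comm]
  have m1 : ∫ x, ((inner ℝ ξ x : ℝ) : ℂ) ∂μ = 0 := by rw [integral_complex_ofReal, m0]; simp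
  simp only [m1, e2]
  push_cast
  congr 1
  ring

variable {κ : Type*} [Fintype κ]

lemma sm_super (h0 : μ[id] = 0)
    {β : ℝ} (hβ : 0 < β) {W : Type*} [Fintype W] [DecidableEq W] (w : ι → W) (nb : W → W → Prop)
    [DecidableRel nb] (nbs : ∀ v v', nb v v' → nb v' v) (R : ℕ)
    (hR : ∀ v, (Finset.univ.filter (nb v)).card ≤ R) (c1 : ∀ i j, cv μ i j ≤ 1) {K : ℝ} (K0 : 0 ≤ K)
    (cK : ∀ i j, ¬ nb (w i) (w j) → cv μ i j ≤ K) {τ : ℝ} (τ0 : 0 < τ) (τ1 : τ < 1)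
    (hτ : ∀ v, ∫ x, ∑ i with w i = v, pm β i x ∂μ ≤ τ) {θ : ℝ} (θ0 : 0 ≤ θ)
    (hθ : θ ^ 2 * (K + R / (log (1 / τ) / 2)) ≤ 1) {s : ℝ} (hs : s ^ 2 = 1) :
    ∫ x, exp (s * θ * (sm β x - ∫ y, sm β y ∂μ)) ∂μ ≤ 64 := by
  obtain ⟨b, hb⟩ := exists_b μ h0
  set m := ∫ y, sm β y ∂μ with hm
  set K' := K + R / (log (1 / τ) / 2) with hK'
  set f : EE ι → ℝ := fun x => sm β x - m with hf
  have cf : C1E f (pm β) := by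
    refine ⟨fun x => ((sm_C1E hβ).deriv x).sub_const m, ?_, pm_EG β⟩
    have := ((sm_C1E (ι := ι) hβ).eg).add (cEG (-m))
    exact this
  have fa : ∀ x, |f x| ≤ (log (Fintype.card ι) / β + |m|) + ‖x‖ := fun x => by
    have := abs_sub (sm β x) m
    have := sm_abs hβ x
    simp only [hf]; linarith
  have vb : ∀ {F g : EE ι → ℝ}, C1E F (fun i x => pm β i x * g x) → EG g → (∀ x, 0 ≤ g x) →
      ∫ x, F x * F x ∂μ - (∫ x, F x ∂μ) * (∫ x, F x ∂μ) ≤ K' * ∫ x, g x ^ 2 ∂μ := fun hF hg g0 =>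
    var_bound μ h0 b hb hF (pm_EG β) hg (pm_nonneg β) (pm_sum β) g0 w nb nbs R hR c1 K0 cK τ0 τ1 hτ
  have v1 := vb (F := f) (g := fun _ => 1) (by simpa using cf) (cEG 1) (fun _ => zero_le_one)
  have f0 : ∫ x, f x ∂μ = 0 := by
    simp only [hf]
    rw [integral_sub ((sm_C1E hβ).eg.int μ) (integrable_const _)]
    simp [hm]
  simp only [f0, mul_zero, sub_zero, one_pow, integral_const, probReal_univ, smul_eq_mul, mul_one] at v1
  have cF := cf.expc fa s (s * θ / 2)
  have eg2 : EG (fun x => θ / 2 * exp (s * θ / 2 * f x)) := (cEG (θ / 2)).mul (expEG cf.eg.cont fa _)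
  have v2 := vb (F := fun x => s * exp (s * θ / 2 * f x)) (g := fun x => θ / 2 * exp (s * θ / 2 * f x))
    (by
      convert cF using 4
      rw [show s * (s * θ / 2) = s ^ 2 * θ / 2 by ring, hs]; ring) eg2 (fun x => by positivity)
  have e1 : ∀ x, s * exp (s * θ / 2 * f x) * (s * exp (s * θ / 2 * f x)) = exp (s * θ * f x) := fun x => by
    rw [mul_mul_mul_comm, ← pow_two s, hs, ← exp_add, one_mul]; congr 1; ring
  have e2 : ∀ x, (θ / 2 * exp (s * θ / 2 * f x)) ^ 2 = θ ^ 2 / 4 * exp (s * θ * f x) := fun x => by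
    rw [mul_pow, ← exp_nat_mul]; push_cast; congr 1
    · ring
    · congr 1; ring
  simp only [e1, e2, integral_const_mul] at v2
  have e3 : ∀ x, s * θ / 2 * f x = s * θ * f x / 2 := fun x => by ring
  simp only [e3] at v2
  have ei : ∀ r, Integrable (fun x => exp (r * f x)) μ := fun r => (expEG cf.eg.cont fa r).int μ
  refine exp_one_step μ (fun x => s * θ * f x) ?_ (ei _) ?_ ?_ ?_
  · simpa [e3] using ei (s * θ / 2)
  · simp only [mul_pow]
    exact (cf.eg.sq.int μ).const_mul _
  · simp only [mul_pow, hs, one_mul, integral_const_mul]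
    simp only [← pow_two] at v1
    nlinarith [sq_nonneg θ]
  · have pos : 0 ≤ ∫ x, exp (s * θ * f x) ∂μ := integral_nonneg fun x => (exp_pos _).le
    have : (∫ x, exp (s * θ * f x / 2) ∂μ) ^ 2 = s * (∫ x, exp (s * θ * f x / 2) ∂μ) * (s * ∫ x, exp (s * θ * f x / 2) ∂μ) := by
      rw [mul_mul_mul_comm, ← pow_two s, hs]; ring
    rw [this]
    refine v2.trans ?_
    nlinarith [mul_le_mul_of_nonneg_right hθ pos]

lemma mx_super (h0 : μ[id] = 0)
    {β : ℝ} (hβ : 0 < β) {W : Type*} [Fintype W] [DecidableEq W] (w : ι → W) (nb : W → W → Prop)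
    [DecidableRel nb] (nbs : ∀ v v', nb v v' → nb v' v) (R : ℕ)
    (hR : ∀ v, (Finset.univ.filter (nb v)).card ≤ R) (c1 : ∀ i j, cv μ i j ≤ 1) {K : ℝ} (K0 : 0 ≤ K)
    (cK : ∀ i j, ¬ nb (w i) (w j) → cv μ i j ≤ K) {τ : ℝ} (τ0 : 0 < τ) (τ1 : τ < 1)
    (hτ : ∀ v, ∫ x, ∑ i with w i = v, pm β i x ∂μ ≤ τ) {θ : ℝ} (θ0 : 0 ≤ θ)
    (hθ : θ ^ 2 * (K + R / (log (1 / τ) / 2)) ≤ 1) {s : ℝ} (hs : s ^ 2 = 1)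
    (hβθ : θ * log (Fintype.card ι) ≤ β) :
    ∫ x, exp (s * θ * (mx x - ∫ y, mx y ∂μ)) ∂μ ≤ 192 := by
  have h1 := mx_cmp μ hβ (s * θ)
  have h2 := sm_super μ h0 hβ w nb nbs R hR c1 K0 cK τ0 τ1 hτ θ0 hθ hs
  have sa : |s| = 1 := by
    rw [← sq_abs] at hs; nlinarith [abs_nonneg s]
  have h3 : exp (|s * θ| * (log (Fintype.card ι) / β)) ≤ 3 := by
    refine le_trans (exp_le_exp.2 ?_) (exp_one_lt_d9.le.trans (by norm_num) : exp 1 ≤ 3)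
    rw [abs_mul, sa, abs_of_nonneg θ0, one_mul, ← mul_div_assoc, div_le_one hβ]
    exact hβθ
  have h4 : 0 ≤ ∫ x, exp (s * θ * (sm β x - ∫ y, sm β y ∂μ)) ∂μ := integral_nonneg fun x => (exp_pos _).le
  calc _ ≤ _ := h1
    _ ≤ 3 * 64 := by gcongr
    _ = 192 := by norm_num
end super


section lower
variable {ι : Type*} [Fintype ι] [Nonempty ι] [DecidableEq ι] (μ : Measure (EE ι)) [IsGaussian μ]

lemma pm_eq (β : ℝ) (hβ : β ≠ 0) (i : ι) (x : EE ι) : pm β i x = exp (β * (x i - sm β x)) := by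
  rw [pm, sm, mul_sub, mul_div_cancel₀ _ hβ, exp_sub, exp_log (ss_pos β x)]

lemma pm_C1E {β : ℝ} (hβ : 0 < β) (i : ι) : C1E (pm β i : EE ι → ℝ)
    (fun j x => β * (pm β i x * ((if j = i then 1 else 0) - pm β j x))) := by
  refine ⟨fun x => ?_, pm_EG β i, fun j => ?_⟩
  · have h1 := (EuclideanSpace.proj i : EE ι →L[ℝ] ℝ).hasFDerivAt (x := x)
    have h2 := ((h1.sub ((sm_C1E hβ).deriv x)).const_mul β).exp
    have e : (pm β i : EE ι → ℝ) = fun x => exp (β * (x i - sm β x)) := by ext x; exact pm_eq β hβ.ne' i x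
    rw [e]
    convert! h2 using 1
    ext y
    simp [mul_sub, sub_mul, Finset.sum_sub_distrib, Finset.mul_sum]
    have e3 : exp (β * x i - β * sm β x) = pm β i x := by rw [pm_eq β hβ.ne', mul_sub]
    rw [e3]
    congr 1
    · ring
    · refine Finset.sum_congr rfl fun j _ => ?_
      ring
  · have := (cEG β).mul ((pm_EG β i).mul ((cEG (if j = i then 1 else 0)).add ((cEG (-1)).mul (pm_EG (ι := ι) β j))))
    simpa [EG, sub_eq_add_neg] using this

lemma one_sub_exp {U u : ℝ} (hU : log 2 ≤ U) (u0 : 0 ≤ u) (uU : u ≤ U) : u / (2 * U) ≤ 1 - exp (-u) := by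
  have l2 : 0 < log 2 := log_pos (by norm_num)
  have U0 : 0 < U := by linarith
  have h' := convexOn_exp.2
  have h := h' (Set.mem_univ 0) (Set.mem_univ (-U)) (show 0 ≤ 1 - u / U by
    rw [sub_nonneg, div_le_one U0]; exact uU) (show 0 ≤ u / U by positivity) (by ring)
  simp only [smul_eq_mul, mul_zero, zero_add, exp_zero, mul_one, mul_neg] at h
  rw [div_mul_cancel₀ _ U0.ne'] at h
  have h2 : exp (-U) ≤ 1 / 2 := by
    rw [exp_neg, one_div]
    apply inv_anti₀ (by norm_num)
    rw [← exp_log (show (0:ℝ) < 2 by norm_num)]; exact exp_le_exp.2 hU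
  have h3 : 0 ≤ u / U := by positivity
  have h4 : u / (2 * U) = u / U / 2 := by field_simp
  rw [h4]; nlinarith

lemma mean_lower (h0 : μ[id] = 0) (hn : 2 ≤ Fintype.card ι) (c1 : ∀ i, cv μ i i = 1)
    (c2 : ∀ i j, i ≠ j → cv μ i j ≤ 1 / 2) : √(log (Fintype.card ι)) ≤ 5 * ∫ x, mx x ∂μ := by
  set n := Fintype.card ι with hnn
  have hn' : (2 : ℝ) ≤ n := by exact_mod_cast hn
  set U := log n with hU
  have U2 : log 2 ≤ U := log_le_log (by norm_num) hn'
  have l2 : 0 < log 2 := log_pos (by norm_num)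
  have U0 : 0 < U := by linarith
  set β := √U with hβ
  have b0 : 0 < β := sqrt_pos.2 U0
  have bU : β ^ 2 = U := sq_sqrt U0.le
  have i1 : Integrable (mx : EE ι → ℝ) μ := mx_EG.int μ
  have i2 : Integrable (sm β : EE ι → ℝ) μ := (sm_C1E b0).eg.int μ
  have ipx : ∀ i, Integrable (fun x : EE ι => pm β i x * x i) μ := fun i => ((pm_EG β i).mul (coord_EG i)).at () |>.int μ
  set T : ι → ι → ℝ := fun i j => ∫ x, β * (pm β i x * ((if j = i then 1 else 0) - pm β j x)) ∂μ with hT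
  have iT : ∀ i j, Integrable (fun x => β * (pm β i x * ((if j = i then 1 else 0) - pm β j x))) μ := fun i j =>
    ((pm_C1E b0 i).eg' j).int μ
  have s1 : ∑ i, ∑ j, cv μ j i * T i j ≤ ∫ x, mx x ∂μ := by
    have : ∀ i, ∑ j, cv μ j i * T i j = ∫ x, pm β i x * x i ∂μ := fun i => (ibp μ h0 (pm_C1E b0 i) i).symm
    simp only [this]
    rw [← integral_finsetSum _ fun i _ => ipx i]
    refine integral_mono (integrable_finsetSum _ fun i _ => ipx i) i1 fun x => ?_
    calc ∑ i, pm β i x * x i ≤ ∑ i, pm β i x * mx x := Finset.sum_le_sum fun i _ =>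
          mul_le_mul_of_nonneg_left (le_mx x i) (pm_nonneg β i x)
      _ = _ := by rw [← Finset.sum_mul, pm_sum, one_mul]
  have T0 : ∀ i, ∑ j, T i j = 0 := by
    intro i
    rw [← integral_finsetSum _ fun j _ => iT i j]
    simp [← Finset.mul_sum, Finset.sum_sub_distrib, pm_sum]
  have s2 : (1 / 2) * ∑ i, T i i ≤ ∑ i, ∑ j, cv μ j i * T i j := by
    rw [Finset.mul_sum]
    refine Finset.sum_le_sum fun i _ => ?_
    have : (1 / 2) * T i i = ∑ j, ((1 / 2) * T i j + if j = i then (1 / 2) * T i j else 0) := by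
      rw [Finset.sum_add_distrib, ← Finset.mul_sum, T0]; simp
    rw [this]
    refine Finset.sum_le_sum fun j _ => ?_
    by_cases h : j = i
    · subst h; simp [c1]; linarith
    · simp only [h, if_false, add_zero]
      have : T i j ≤ 0 := integral_nonpos fun x => by
        simp only [h, if_false, zero_sub]
        have := mul_nonneg b0.le (mul_nonneg (pm_nonneg β i x) (pm_nonneg β j x))
        simp only [Pi.zero_apply]; linarith
      nlinarith [c2 j i h]
  have s3 : β * (β * (∫ x, sm β x ∂μ - ∫ x, mx x ∂μ) / (2 * U)) ≤ ∑ i, T i i := by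
    rw [← integral_finsetSum _ fun i _ => iT i i, ← integral_sub i2 i1, ← integral_const_mul, ← integral_div,
      ← integral_const_mul]
    refine integral_mono ((((i2.sub i1).const_mul β).div_const _).const_mul β) (integrable_finsetSum _ fun i _ => iT i i) fun x => ?_
    simp only [if_true]
    rw [← Finset.mul_sum]
    refine mul_le_mul_of_nonneg_left ?_ b0.le
    have h1 := mx_le_sm b0 x
    have h2 := sm_le b0 x
    have u1 : β * (sm β x - mx x) ≤ U := by
      have : β * (U / β) = U := by field_simp
      rw [← this]; gcongr; linarith
    refine (one_sub_exp U2 (mul_nonneg b0.le (by linarith)) u1).trans ?_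
    have : 1 - exp (-(β * (sm β x - mx x))) = ∑ i, pm β i x * (1 - exp (-(β * (sm β x - mx x)))) := by
      rw [← Finset.sum_mul, pm_sum, one_mul]
    rw [this]
    refine Finset.sum_le_sum fun i _ => mul_le_mul_of_nonneg_left ?_ (pm_nonneg β i x)
    have : pm β i x ≤ exp (-(β * (sm β x - mx x))) := by
      rw [pm_eq β b0.ne']
      apply exp_le_exp.2
      nlinarith [le_mx x i]
    linarith
  have s4 : U / β ≤ ∫ x, sm β x ∂μ := by
    have iav : Integrable (fun x : EE ι => U / β + ∑ i, (1 / n : ℝ) * x i) μ :=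
      (integrable_const _).add (integrable_finsetSum _ fun i _ => ((coord_EG i).int μ).const_mul _)
    have : ∫ x : EE ι, U / β + ∑ i, (1 / n : ℝ) * x i ∂μ = U / β := by
      rw [integral_add (integrable_const _) (integrable_finsetSum _ fun i _ => ((coord_EG i).int μ).const_mul _),
        integral_finsetSum _ fun i _ => ((coord_EG i).int μ).const_mul _]
      simp [integral_const_mul, coord_zero μ h0]
    rw [← this]
    refine integral_mono iav i2 fun x => ?_
    have hj := convexOn_exp.map_sum_le (t := Finset.univ) (w := fun _ : ι => (1 / n : ℝ)) (p := fun i => β * x i)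
      (fun i _ => by positivity) (by simp [← hnn]) (fun i _ => Set.mem_univ _)
    simp only [smul_eq_mul, ← Finset.mul_sum] at hj
    have h6 : n * exp (1 / n * (β * ∑ i, x i)) ≤ ss β x := by
      have : (n : ℝ) * (1 / n * ss β x) = ss β x := by field_simp
      rw [← this]; gcongr; exact hj
    have h7 := log_le_log (by positivity) h6
    rw [log_mul (by positivity) (exp_pos _).ne', log_exp] at h7
    simp only [sm]
    rw [le_div_iff₀ b0, add_mul, div_mul_cancel₀ _ b0.ne', ← Finset.mul_sum]
    linarith
  set m := ∫ x, mx x ∂μ with hm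
  have s5 : β * (β * (U / β - m) / (2 * U)) ≤ 2 * m := by
    calc _ ≤ β * (β * (∫ x, sm β x ∂μ - m) / (2 * U)) := by gcongr
      _ ≤ _ := by linarith
  have : β * (β * (U / β - m) / (2 * U)) = (β - m) / 2 := by
    rw [← bU]; field_simp
  rw [this] at s5
  linarith
end lower


structure GF {Ω : Type*} [MeasurableSpace Ω] (P : Measure Ω) {d : ℕ} (X : EuclideanSpace ℝ (Fin d) → Ω → ℝ)
    (φ : ℝ → ℝ) : Prop where
  meas : ∀ s, Measurable (X s)
  cont : ∀ ω, Continuous fun s => X s ω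
  gauss : ∀ (k : ℕ) (s : Fin k → EuclideanSpace ℝ (Fin d)) (a : Fin k → ℝ),
      ∃ v : NNReal, P.map (fun ω => ∑ i, a i * X (s i) ω) = gaussianReal 0 v
  phi0 : φ 0 = 1
  cov : ∀ s t, ∫ ω, X s ω * X t ω ∂P = φ (dist s t)
  mono : ∀ x y, 0 ≤ x → x ≤ y → φ y ≤ φ x
  phi1 : φ 1 < 1 / 2

section link
variable {Ω : Type*} [MeasurableSpace Ω] {P : Measure Ω} [IsProbabilityMeasure P] {d : ℕ}
  {X : EuclideanSpace ℝ (Fin d) → Ω → ℝ} {φ : ℝ → ℝ} (g : GF P X φ) {ι : Type*} [Fintype ι]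

def vec (X : EuclideanSpace ℝ (Fin d) → Ω → ℝ) (T : ι → EuclideanSpace ℝ (Fin d)) (ω : Ω) : EE ι :=
  WithLp.toLp 2 (fun i => X (T i) ω)

noncomputable def MT (X : EuclideanSpace ℝ (Fin d) → Ω → ℝ) (T : ι → EuclideanSpace ℝ (Fin d)) (ω : Ω) : ℝ :=
  ⨆ i, X (T i) ω

include g in
lemma GF.vmeas (T : ι → EuclideanSpace ℝ (Fin d)) : Measurable (vec X T) := by
  unfold vec
  exact (PiLp.continuous_toLp 2 _).measurable.comp (measurable_pi_lambda _ fun i => g.meas _)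

include g in
lemma GF.lgauss (T : ι → EuclideanSpace ℝ (Fin d)) : IsGaussian (P.map (vec X T)) := by
  classical
  refine isGaussian_of_map_eq_gaussianReal fun L => ?_
  rw [Measure.map_map L.continuous.measurable (g.vmeas T)]
  let e := (Fintype.equivFin ι).symm
  obtain ⟨v, hv⟩ := g.gauss (Fintype.card ι) (fun i => T (e i)) (fun i => L (EuclideanSpace.single (e i) 1))
  refine ⟨0, v, ?_⟩
  rw [← hv]
  congr 1
  ext ω
  simp only [Function.comp]
  have h1 : vec X T ω = ∑ i, X (T i) ω • EuclideanSpace.single i (1 : ℝ) := by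
    ext j
    simp [vec, Finset.sum_apply, Pi.single_apply]
  rw [h1, map_sum, ← e.sum_comp]
  refine Finset.sum_congr rfl fun i _ => ?_
  rw [map_smul, smul_eq_mul, mul_comm]

include g in
lemma GF.lint_map (T : ι → EuclideanSpace ℝ (Fin d)) {H : EE ι → ℝ} (hH : Continuous H) :
    ∫ x, H x ∂(P.map (vec X T)) = ∫ ω, H (vec X T ω) ∂P :=
  integral_map (g.vmeas T).aemeasurable hH.aestronglyMeasurable

include g in
lemma GF.lcv (T : ι → EuclideanSpace ℝ (Fin d)) (i j : ι) : cv (P.map (vec X T)) i j = φ (dist (T i) (T j)) := by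
  rw [cv, g.lint_map T (by fun_prop), ← g.cov]
  rfl

include g in
lemma GF.lzero (T : ι → EuclideanSpace ℝ (Fin d)) : (P.map (vec X T))[id] = 0 := by
  haveI := g.lgauss T
  ext i
  have h2 := IsGaussian.integral_dual (μ := P.map (vec X T)) (EuclideanSpace.proj i : EE ι →L[ℝ] ℝ)
  have h1 : ∫ x, (EuclideanSpace.proj i : EE ι →L[ℝ] ℝ) x ∂(P.map (vec X T)) = 0 := by
    rw [g.lint_map T (by fun_prop)]
    obtain ⟨v, hv⟩ := g.gauss 1 (fun _ => T i) (fun _ => 1)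
    have : ∫ x, x ∂(P.map (fun ω => X (T i) ω)) = 0 := by
      simp only [Finset.univ_unique, one_mul, Finset.sum_singleton] at hv
      rw [hv, integral_id_gaussianReal]
    rw [integral_map (g.meas _).aemeasurable (by fun_prop)] at this
    exact this
  rw [h1] at h2
  exact h2.symm

include g in
lemma GF.le_one (x : ℝ) (hx : 0 ≤ x) : φ x ≤ 1 := by
  rw [← g.phi0]; exact g.mono 0 x le_rfl hx

lemma charFun_cv (μ : Measure (EE ι)) [IsGaussian μ] (h0 : μ[id] = 0) (ξ : EE ι) :
    charFun μ ξ = Complex.exp (-(∑ i, ∑ j, ξ i * ξ j * cv μ i j : ℝ) / 2) := by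
  have hco : ∀ i j, Integrable (fun x : EE ι => x i * x j) μ := fun i j => ((coord_EG i).mul (coord_EG j)).at () |>.int μ
  have quad : ∫ x, (∑ i, ξ i * x i) ^ 2 ∂μ = ∑ i, ∑ j, ξ i * ξ j * cv μ i j := by
    have : ∀ x : EE ι, (∑ i, ξ i * x i) ^ 2 = ∑ i, ∑ j, ξ i * ξ j * (x i * x j) := by
      intro x; rw [pow_two, Finset.sum_mul_sum]
      refine Finset.sum_congr rfl fun i _ => Finset.sum_congr rfl fun j _ => by ring
    simp only [this]
    rw [integral_finsetSum _ fun i _ => integrable_finsetSum _ fun j _ => (hco i j).const_mul _]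
    refine Finset.sum_congr rfl fun i _ => ?_
    rw [integral_finsetSum _ fun j _ => (hco i j).const_mul _]
    refine Finset.sum_congr rfl fun j _ => ?_
    rw [integral_const_mul]; rfl
  rw [IsGaussian.charFun_eq]
  have m0 : ∫ x, inner ℝ ξ x ∂μ = 0 := by
    have h := IsGaussian.integral_dual (μ := μ) (innerSL ℝ ξ)
    simp only [id] at h0
    rw [h0] at h
    simpa using h
  have e2 : Var[fun x => inner ℝ ξ x; μ] = ∑ i, ∑ j, ξ i * ξ j * cv μ i j := by
    rw [variance_of_integral_eq_zero (by fun_prop) m0, ← quad]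
    have : ∀ x : EE ι, inner ℝ ξ x = ∑ i, ξ i * x i := fun x => by
      simp [PiLp.inner_apply, mul_comm]
    simp only [this]
  have m1 : ∫ x, ((inner ℝ ξ x : ℝ) : ℂ) ∂μ = 0 := by rw [integral_complex_ofReal, m0]; simp
  simp only [m1, e2]
  congr 1
  ring

include g in
lemma GF.shift (T : ι → EuclideanSpace ℝ (Fin d)) (v : EuclideanSpace ℝ (Fin d)) :
    P.map (vec X T) = P.map (vec X (fun i => T i - v)) := by
  haveI := g.lgauss T
  haveI := g.lgauss (fun i => T i - v)
  refine Measure.ext_of_charFun ?_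
  ext ξ
  rw [charFun_cv _ (g.lzero T), charFun_cv _ (g.lzero _)]
  simp only [g.lcv, dist_sub_right]

variable [Nonempty ι]

include g in
lemma GF.mean_shift (T : ι → EuclideanSpace ℝ (Fin d)) (v : EuclideanSpace ℝ (Fin d)) :
    ∫ ω, MT X T ω ∂P = ∫ ω, MT X (fun i => T i - v) ω ∂P := by
  have h1 := g.lint_map T (H := mx) mx_cont
  have h2 := g.lint_map (fun i => T i - v) (H := mx) mx_cont
  rw [← g.shift T v, h1] at h2
  exact h2

include g in
lemma GF.MTmeas (T : ι → EuclideanSpace ℝ (Fin d)) : Measurable (MT X T) :=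
  (mx_cont.measurable.comp (g.vmeas T) : Measurable (fun ω => mx (vec X T ω)))

include g in
lemma GF.MTint (T : ι → EuclideanSpace ℝ (Fin d)) : Integrable (MT X T) P := by
  haveI := g.lgauss T
  exact (mx_EG.int (P.map (vec X T))).comp_measurable (g.vmeas T)

include g in
lemma GF.MTexpint (T : ι → EuclideanSpace ℝ (Fin d)) (θ m : ℝ) : Integrable (fun ω => exp (θ * (MT X T ω - m))) P := by
  haveI := g.lgauss T
  exact (mx_exp_int (P.map (vec X T)) θ m).comp_measurable (g.vmeas T)

include g in
lemma GF.MTherbst (T : ι → EuclideanSpace ℝ (Fin d)) (θ : ℝ) :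
    ∫ ω, exp (θ * (MT X T ω - ∫ ω', MT X T ω' ∂P)) ∂P ≤ exp (θ ^ 2 / 2) := by
  haveI := g.lgauss T
  have h1 := g.lint_map T (H := mx) mx_cont
  have h := mx_herbst (P.map (vec X T)) (g.lzero T) (fun i j => by rw [g.lcv]; exact g.le_one _ dist_nonneg) θ
  have := mx_cont (ι := ι)
  rw [h1, g.lint_map T (by fun_prop)] at h
  exact h

include g in
lemma GF.upper (T : ι → EuclideanSpace ℝ (Fin d)) {s : ℝ} (hs : 0 ≤ s) :
    P.real {ω | ∫ ω', MT X T ω' ∂P + s ≤ MT X T ω} ≤ exp (-s ^ 2 / 2) := by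
  set m := ∫ ω', MT X T ω' ∂P with hm
  have h := measure_ge_le_exp_mul_mgf (μ := P) (X := fun ω => MT X T ω - m) s hs (g.MTexpint T s m)
  have h2 := g.MTherbst T s
  rw [← hm] at h2
  have e : {ω | m + s ≤ MT X T ω} = {ω | s ≤ MT X T ω - m} := by ext ω; simp only [Set.mem_ofPred_eq]; constructor <;> intro h <;> linarith
  rw [e]
  refine h.trans ((mul_le_mul_of_nonneg_left h2 (exp_pos _).le).trans_eq ?_)
  rw [← exp_add]; congr 1; ring

include g in
lemma GF.lower (T : ι → EuclideanSpace ℝ (Fin d)) {s : ℝ} (hs : 0 ≤ s) :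
    P.real {ω | MT X T ω ≤ ∫ ω', MT X T ω' ∂P - s} ≤ exp (-s ^ 2 / 2) := by
  set m := ∫ ω', MT X T ω' ∂P with hm
  have h := measure_le_le_exp_mul_mgf (μ := P) (X := fun ω => MT X T ω - m) (t := -s) (-s) (by linarith) (g.MTexpint T (-s) m)
  have h2 := g.MTherbst T (-s)
  rw [← hm] at h2
  have e : {ω | MT X T ω ≤ m - s} = {ω | MT X T ω - m ≤ -s} := by ext ω; simp only [Set.mem_ofPred_eq]; constructor <;> intro h <;> linarith
  rw [e]
  refine h.trans ((mul_le_mul_of_nonneg_left h2 (exp_pos _).le).trans_eq ?_)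
  rw [← exp_add]; congr 1; ring

include g in
lemma GF.bdd {A : Set (EuclideanSpace ℝ (Fin d))} (hA : Bornology.IsBounded A) (ω : Ω) :
    ∃ b, ∀ s ∈ A, X s ω ≤ b := by
  have hc : IsCompact (closure A) := hA.isCompact_closure
  obtain ⟨b, hb⟩ := (hc.image (g.cont ω)).bddAbove
  exact ⟨b, fun s hs => hb ⟨s, subset_closure hs, rfl⟩⟩

include g in
lemma GF.mean_bdd {A : Set (EuclideanSpace ℝ (Fin d))} (hA : Bornology.IsBounded A) :
    ∃ κ : ℝ, 0 ≤ κ ∧ ∀ {ι : Type} [Fintype ι] [Nonempty ι] (T : ι → EuclideanSpace ℝ (Fin d)), (∀ i, T i ∈ A) →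
      ∫ ω, MT X T ω ∂P ≤ κ := by
  set S : ℕ → Set Ω := fun n => {ω | ∀ s ∈ A, X s ω ≤ n} with hS
  have mono : Monotone S := fun n m hnm ω hω s hs => (hω s hs).trans (by exact_mod_cast hnm)
  have un : ⋃ n, S n = Set.univ := by
    ext ω; simp only [Set.mem_iUnion, Set.mem_univ, iff_true]
    obtain ⟨b, hb⟩ := g.bdd hA ω
    obtain ⟨n, hn⟩ := exists_nat_ge b
    exact ⟨n, fun s hs => (hb s hs).trans hn⟩
  have t := tendsto_measure_iUnion_atTop (μ := P) mono
  rw [un, measure_univ] at t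
  have : (ENNReal.ofReal (1 / 2)) < 1 := by
    rw [← ENNReal.ofReal_one]; exact (ENNReal.ofReal_lt_ofReal_iff (by norm_num)).2 (by norm_num)
  obtain ⟨n, hn⟩ := (t.eventually (lt_mem_nhds this)).exists
  refine ⟨n + 2, by positivity, fun {ι} _ _ T hT => ?_⟩
  by_contra hcon
  push Not at hcon
  have h1 := g.lower T (s := 2) (by norm_num)
  have h2 : P (S n) ≤ P {ω | MT X T ω ≤ ∫ ω', MT X T ω' ∂P - 2} := by
    refine measure_mono fun ω hω => ?_
    have : MT X T ω ≤ n := ciSup_le fun i => hω _ (hT i)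
    simp only [Set.mem_ofPred_eq]; linarith
  have h3 := hn.le.trans h2
  rw [← ENNReal.ofReal_toReal (measure_ne_top P {ω | MT X T ω ≤ ∫ ω', MT X T ω' ∂P - 2})] at h3
  have h4 := (ENNReal.ofReal_le_ofReal_iff ENNReal.toReal_nonneg).1 h3
  have h5 : exp (-2 ^ 2 / 2) < 1 / 2 := by
    have : exp (-2 ^ 2 / 2) = (exp 2)⁻¹ := by rw [← exp_neg]; norm_num
    rw [this, one_div]
    apply inv_strictAnti₀ (by norm_num)
    linarith [add_one_le_exp (2:ℝ)]
  have : P.real {ω | MT X T ω ≤ ∫ ω', MT X T ω' ∂P - 2} = (P {ω | MT X T ω ≤ ∫ ω', MT X T ω' ∂P - 2}).toReal := rfl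
  linarith
end link


section cells
variable {Ω : Type*} [MeasurableSpace Ω] {P : Measure Ω} [IsProbabilityMeasure P] {d : ℕ}
  {X : EuclideanSpace ℝ (Fin d) → Ω → ℝ} {φ : ℝ → ℝ} (g : GF P X φ)

noncomputable def zf (x : EuclideanSpace ℝ (Fin d)) : Fin d → ℤ := fun i => ⌊x i⌋
noncomputable def cell (l : ℕ) (x : EuclideanSpace ℝ (Fin d)) : Fin d → ℤ := fun i => ⌊x i⌋ / (l : ℤ)

def nbr (v v' : Fin d → ℤ) : Prop := ∀ i, |v i - v' i| ≤ 1

lemma nbr_symm (v v' : Fin d → ℤ) (h : nbr v v') : nbr v' v := fun i => by rw [abs_sub_comm]; exact h i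

lemma cell_far {l : ℕ} (hl : 0 < l) {x y : EuclideanSpace ℝ (Fin d)} (h : ¬ nbr (cell l x) (cell l y)) :
    (l : ℝ) ≤ dist x y := by
  by_contra hcon
  push Not at hcon
  apply h
  have key : ∀ x y : EuclideanSpace ℝ (Fin d), dist x y < l → ∀ i, cell l x i ≤ cell l y i + 1 := by
    intro x y hd i
    have h1 : |x i - y i| ≤ dist x y := by
      rw [dist_eq_norm]; simpa using coord_le (x - y) i
    have h2 : x i < y i + l := by linarith [(abs_le.1 h1).2]
    have h3 : ⌊x i⌋ ≤ ⌊y i⌋ + l := by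
      have a1 := Int.floor_le (x i)
      have a2 := Int.lt_floor_add_one (y i)
      have : ((⌊x i⌋ : ℤ) : ℝ) < ((⌊y i⌋ + 1 + l : ℤ) : ℝ) := by push_cast; linarith
      have := Int.cast_lt.1 this
      omega
    have hl' : (0 : ℤ) < l := by exact_mod_cast hl
    calc cell l x i ≤ (⌊y i⌋ + l) / (l : ℤ) := Int.ediv_le_ediv hl' h3
      _ = cell l y i + 1 := by rw [Int.add_ediv_of_dvd_right (dvd_refl _), Int.ediv_self hl'.ne']; rfl
  intro i
  have k1 := key x y hcon i
  have k2 := key y x (by rwa [dist_comm]) i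
  rw [abs_le]; constructor <;> linarith

lemma nbr_card (W : Finset (Fin d → ℤ)) (v : W) [DecidableRel fun a b : W => nbr a.1 b.1] :
    (Finset.univ.filter (fun b : W => nbr v.1 b.1)).card ≤ 3 ^ d := by
  classical
  have : (Fintype.piFinset fun i : Fin d => Finset.Icc (v.1 i - 1) (v.1 i + 1)).card = 3 ^ d := by
    rw [Fintype.card_piFinset]
    simp [show ∀ z : ℤ, z + 1 + 1 - (z - 1) = 3 from fun z => by ring]
  rw [← this]
  refine Finset.card_le_card_of_injOn (fun b => b.1) (fun b hb => ?_) (fun a _ b _ h => Subtype.ext h)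
  simp only [Finset.coe_filter, Finset.mem_univ, true_and] at hb
  simp only [Finset.mem_coe, Fintype.mem_piFinset, Finset.mem_Icc]
  intro i
  have := abs_le.1 (hb i)
  constructor <;> linarith

include g in
lemma GF.cube_tail : ∃ κ : ℝ, 0 ≤ κ ∧ ∀ {ι : Type} [Fintype ι] (T : ι → EuclideanSpace ℝ (Fin d)) (z : Fin d → ℤ)
    (a : ℝ), κ ≤ a → P.real {ω | ∃ i, zf (T i) = z ∧ a < X (T i) ω} ≤ exp (-(a - κ) ^ 2 / 2) := by
  classical
  have hb : Bornology.IsBounded {x : EuclideanSpace ℝ (Fin d) | zf x = 0} := by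
    refine (Metric.isBounded_closedBall (x := (0 : EuclideanSpace ℝ (Fin d))) (r := √d)).subset fun x hx => ?_
    rw [mem_closedBall_zero_iff, EuclideanSpace.norm_eq]
    apply sqrt_le_sqrt
    calc ∑ i, ‖x i‖ ^ 2 ≤ ∑ i : Fin d, (1 : ℝ) := Finset.sum_le_sum fun i _ => by
          have h1 : ⌊x i⌋ = 0 := congrFun hx i
          have h2 := Int.floor_eq_zero_iff.1 h1
          rw [Real.norm_eq_abs, sq_abs]
          nlinarith [h2.1, h2.2]
      _ = d := by simp
  obtain ⟨κ, k0, hκ⟩ := g.mean_bdd hb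
  refine ⟨κ, k0, fun {ι} _ T z a ha => ?_⟩
  rcases isEmpty_or_nonempty {i // zf (T i) = z} with he | hne
  · have : {ω | ∃ i, zf (T i) = z ∧ a < X (T i) ω} = ∅ := by
      rw [Set.eq_empty_iff_forall_notMem]
      rintro ω ⟨i, hi, -⟩
      exact he.elim ⟨i, hi⟩
    rw [this]; simp only [measureReal_empty]; exact (exp_pos _).le
  · set T' : {i // zf (T i) = z} → EuclideanSpace ℝ (Fin d) := fun i => T i.1 with hT'
    have hm : ∫ ω, MT X T' ω ∂P ≤ κ := by
      rw [g.mean_shift T' (WithLp.toLp 2 fun i => (z i : ℝ))]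
      refine hκ _ fun i => ?_
      show zf _ = 0
      ext j
      have : ⌊T i.1 j⌋ = z j := congrFun i.2 j
      simp [zf, hT', this]
    refine le_trans (measureReal_mono ?_) ((g.upper T' (s := a - ∫ ω, MT X T' ω ∂P) (by linarith)).trans ?_)
    · rintro ω ⟨i, hi, hlt⟩
      have : X (T i) ω ≤ MT X T' ω := le_ciSup (f := fun i => X (T' i) ω) (Set.finite_range _).bddAbove ⟨i, hi⟩
      simp only [Set.mem_ofPred_eq]; linarith
    · apply exp_le_exp.2
      have : (a - κ) ^ 2 ≤ (a - ∫ ω, MT X T' ω ∂P) ^ 2 := by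
        apply pow_le_pow_left₀ <;> linarith
      linarith

include g in
lemma GF.cell_tail : ∃ κ : ℝ, 0 ≤ κ ∧ ∀ {ι : Type} [Fintype ι] (T : ι → EuclideanSpace ℝ (Fin d)) (l : ℕ), 0 < l →
    ∀ (v : Fin d → ℤ) (a : ℝ), κ ≤ a →
    P.real {ω | ∃ i, cell l (T i) = v ∧ a < X (T i) ω} ≤ (l : ℝ) ^ d * exp (-(a - κ) ^ 2 / 2) := by
  classical
  obtain ⟨κ, k0, hκ⟩ := g.cube_tail
  refine ⟨κ, k0, fun {ι} _ T l hl v a ha => ?_⟩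
  set J : Finset (Fin d → ℤ) := Fintype.piFinset fun i => Finset.Ico (l * v i) (l * v i + l) with hJ
  have cJ : J.card = l ^ d := by rw [hJ, Fintype.card_piFinset]; simp
  calc _ ≤ P.real (⋃ z ∈ J, {ω | ∃ i, zf (T i) = z ∧ a < X (T i) ω}) := by
        refine measureReal_mono ?_ (measure_ne_top _ _)
        rintro ω ⟨i, hi, hlt⟩
        simp only [Set.mem_iUnion]
        refine ⟨zf (T i), ?_, i, rfl, hlt⟩
        rw [hJ, Fintype.mem_piFinset]
        intro j
        have h1 : ⌊T i j⌋ / (l : ℤ) = v j := congrFun hi j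
        have hl' : (0 : ℤ) < l := by exact_mod_cast hl
        have h2 := Int.mul_ediv_add_emod ⌊T i j⌋ l
        have h3 := Int.emod_nonneg ⌊T i j⌋ hl'.ne'
        have h4 := Int.emod_lt_of_pos ⌊T i j⌋ hl'
        rw [h1] at h2
        simp only [zf, Finset.mem_Ico]
        constructor <;> linarith
    _ ≤ ∑ z ∈ J, P.real {ω | ∃ i, zf (T i) = z ∧ a < X (T i) ω} := measureReal_biUnion_finset_le _ _
    _ ≤ ∑ z ∈ J, exp (-(a - κ) ^ 2 / 2) := Finset.sum_le_sum fun z _ => hκ T z a ha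
    _ = _ := by rw [Finset.sum_const, cJ]; simp

include g in
lemma GF.tau {ι : Type*} [Fintype ι] [Nonempty ι] (T : ι → EuclideanSpace ℝ (Fin d)) {W : Type*} [DecidableEq W]
    (w : ι → W) (v : W) {β a : ℝ} (hβ : 0 < β) :
    ∫ x, ∑ i with w i = v, pm β i x ∂(P.map (vec X T)) ≤
      P.real {ω | ∃ i, w i = v ∧ a < X (T i) ω} + P.real {ω | MT X T ω ≤ 2 * a} + Fintype.card ι * exp (-(β * a)) := by
  classical
  have cp : ∀ i, Continuous (pm β i : EE ι → ℝ) := fun i => (pm_EG β i).cont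
  rw [g.lint_map T (by fun_prop)]
  set S1 := {ω | ∃ i, w i = v ∧ a < X (T i) ω} with hS1
  set S2 := {ω | MT X T ω ≤ 2 * a} with hS2
  have m1 : MeasurableSet S1 := by
    have : S1 = ⋃ i, ⋃ (_ : w i = v), {ω | a < X (T i) ω} := by ext ω; simp [hS1]
    rw [this]
    exact MeasurableSet.iUnion fun i => MeasurableSet.iUnion fun _ => measurableSet_lt measurable_const (g.meas _)
  have m2 : MeasurableSet S2 := measurableSet_le (g.MTmeas T) measurable_const
  have i1 : Integrable (S1.indicator fun _ => (1 : ℝ)) P := (integrable_const _).indicator m1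
  have i2 : Integrable (S2.indicator fun _ => (1 : ℝ)) P := (integrable_const _).indicator m2
  have := g.lgauss T
  have i0 : Integrable (fun ω => ∑ i with w i = v, pm β i (vec X T ω)) P :=
    ((UG.sum (T := Unit) (Finset.univ.filter fun i => w i = v) (fun i => pm_EG (ι := ι) β i)).at () |>.int (P.map (vec X T))).comp_measurable (g.vmeas T)
  have hm := integral_mono i0 ((i1.add i2).add (integrable_const (Fintype.card ι * exp (-(β * a))))) fun ω => ?_
  · rw [integral_add' (i1.add i2) (integrable_const _), integral_add' i1 i2, integral_indicator_const _ m1,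
      integral_indicator_const _ m2] at hm
    simpa using hm
  · simp only [Pi.add_apply]
    have e0 : 0 ≤ Fintype.card ι * exp (-(β * a)) := by positivity
    have le1 : ∑ i with w i = v, pm β i (vec X T ω) ≤ 1 := by
      rw [← pm_sum β (vec X T ω)]
      exact Finset.sum_le_sum_of_subset_of_nonneg (Finset.filter_subset _ _) fun i _ _ => pm_nonneg β i _
    have n1 : 0 ≤ S1.indicator (fun _ => (1 : ℝ)) ω := Set.indicator_nonneg (fun _ _ => zero_le_one) ω
    have n2 : 0 ≤ S2.indicator (fun _ => (1 : ℝ)) ω := Set.indicator_nonneg (fun _ _ => zero_le_one) ω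
    by_cases h1 : ω ∈ S1
    · rw [Set.indicator_of_mem h1]; linarith
    by_cases h2 : ω ∈ S2
    · rw [Set.indicator_of_mem h2]; linarith
    suffices h : ∑ i with w i = v, pm β i (vec X T ω) ≤ Fintype.card ι * exp (-(β * a)) by linarith
    have h2' : 2 * a < mx (vec X T ω) := not_le.1 h2
    calc _ ≤ ∑ i with w i = v, exp (-(β * a)) := Finset.sum_le_sum fun i hi => by
          have hw : w i = v := by simpa using hi
          rw [pm_eq β hβ.ne']
          apply exp_le_exp.2
          have k1 : X (T i) ω ≤ a := by
            by_contra hc; exact h1 ⟨i, hw, not_le.1 hc⟩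
          have k2 := mx_le_sm hβ (vec X T ω)
          have k3 : (vec X T ω) i ≤ a := k1
          nlinarith
      _ ≤ ∑ i : ι, exp (-(β * a)) := Finset.sum_le_sum_of_subset_of_nonneg (Finset.filter_subset _ _) fun i _ _ => (exp_pos _).le
      _ = _ := by simp
end cells


section fin
variable {Ω : Type*} [MeasurableSpace Ω] {P : Measure Ω} [IsProbabilityMeasure P] {d : ℕ}
  {X : EuclideanSpace ℝ (Fin d) → Ω → ℝ} {φ : ℝ → ℝ} (g : GF P X φ)

include g in
lemma GF.sep_mean {N : ℕ} (hN : 2 ≤ N) (σ : Fin N → EuclideanSpace ℝ (Fin d)) (hσ : ∀ i j, i ≠ j → 1 < dist (σ i) (σ j))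
    {ι : Type*} [Fintype ι] [Nonempty ι] (T : ι → EuclideanSpace ℝ (Fin d)) (hT : ∀ k, ∃ i, T i = σ k) :
    √(log N) / 5 ≤ ∫ ω, MT X T ω ∂P := by
  haveI : Nonempty (Fin N) := ⟨⟨0, by omega⟩⟩
  haveI := g.lgauss σ
  have h := mean_lower (P.map (vec X σ)) (g.lzero σ) (by simpa using hN)
    (fun i => by rw [g.lcv, dist_self, g.phi0])
    (fun i j hij => by
      rw [g.lcv]
      exact (g.mono 1 _ zero_le_one (hσ i j hij).le).trans g.phi1.le)
  rw [Fintype.card_fin, g.lint_map σ mx_cont] at h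
  have h2 : ∫ ω, MT X σ ω ∂P ≤ ∫ ω, MT X T ω ∂P := by
    refine integral_mono (g.MTint σ) (g.MTint T) fun ω => ?_
    refine ciSup_le fun k => ?_
    obtain ⟨i, hi⟩ := hT k
    rw [← hi]
    exact le_ciSup (f := fun i => X (T i) ω) (Set.finite_range _).bddAbove i
  have h3 : ∫ ω, mx (vec X σ ω) ∂P = ∫ ω, MT X σ ω ∂P := rfl
  linarith

lemma exp_split (d : ℕ) {L p q r : ℝ} (hL : log (2 ^ d + 2) ≤ L / 12800)
    (h1 : p ≤ 2 ^ d * exp (-(L / 6400))) (h2 : q ≤ exp (-(L / 6400))) (h3 : r ≤ exp (-(L / 6400))) :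
    p + q + r ≤ exp (-(L / 12800)) := by
  have h4 : (2 : ℝ) ^ d + 2 ≤ exp (L / 12800) := by
    rw [← log_le_iff_le_exp (by positivity)]; exact hL
  calc p + q + r ≤ (2 ^ d + 2) * exp (-(L / 6400)) := by linarith
    _ ≤ exp (L / 12800) * exp (-(L / 6400)) := by gcongr
    _ = _ := by rw [← exp_add]; congr 1; ring

include g in
lemma GF.super_fin : ∃ L0 : ℝ, ∀ N : ℕ, 2 ≤ N → L0 ≤ log N → ∀ (σ : Fin N → EuclideanSpace ℝ (Fin d)),
    (∀ i j, i ≠ j → 1 < dist (σ i) (σ j)) → ∀ {ι : Type} [Fintype ι] [Nonempty ι] (T : ι → EuclideanSpace ℝ (Fin d)),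
    (∀ k, ∃ i, T i = σ k) → ∀ K θ s : ℝ, φ ((N : ℝ) ^ (1 / (6400 * (d + 1) : ℝ))) ≤ K → 1 / log N ≤ K → 0 ≤ θ →
    θ ^ 2 * (K * (1 + 25600 * 3 ^ d)) ≤ 1 → s ^ 2 = 1 →
    ∫ ω, exp (s * θ * (MT X T ω - ∫ ω', MT X T ω' ∂P)) ∂P ≤ 192 := by
  classical
  obtain ⟨κ, k0, hκ⟩ := g.cell_tail
  refine ⟨max ((40 * κ) ^ 2) (12800 * log (2 ^ d + 2)), ?_⟩
  intro N hN hL σ hσ ι _ _ T hT K θ s hK1 hK2 θ0 hθ hs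
  set L := log (N : ℝ) with hLdef
  have N2 : (2 : ℝ) ≤ N := by exact_mod_cast hN
  have Lpos : 0 < L := log_pos (by linarith)
  set x := √L with hx
  have x2 : x ^ 2 = L := sq_sqrt Lpos.le
  have xpos : 0 < x := sqrt_pos.2 Lpos
  have xk : 40 * κ ≤ x := le_sqrt_of_sq_le ((le_max_left _ _).trans hL)
  have hL2 : log (2 ^ d + 2) ≤ L / 12800 := by linarith [(le_max_right _ _).trans hL]
  set C : ℝ := 1 / (6400 * (d + 1)) with hC
  have hNC : (N : ℝ) ^ C = exp (C * L) := by
    rw [rpow_def_of_pos (by linarith)]; congr 1; ring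
  have Cpos : 0 < C := by positivity
  have dC : d * C ≤ 1 / 6400 := by
    rw [hC, mul_one_div, div_le_div_iff₀ (by positivity) (by norm_num)]; nlinarith
  set l : ℕ := ⌈(N : ℝ) ^ C⌉₊ with hl
  have l1 : (N : ℝ) ^ C ≤ l := Nat.le_ceil _
  have e1 : 1 ≤ (N : ℝ) ^ C := by rw [hNC]; apply one_le_exp; positivity
  have l2 : (l : ℝ) ≤ 2 * (N : ℝ) ^ C := by
    have := (Nat.ceil_lt_add_one (by positivity : 0 ≤ (N : ℝ) ^ C)).le
    linarith
  have lpos : 0 < l := Nat.ceil_pos.2 (by positivity)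
  set a := x / 20 with ha
  have apos : 0 < a := by positivity
  set n := Fintype.card ι with hn
  have npos : (0 : ℝ) < n := by exact_mod_cast Fintype.card_pos
  set β := max (θ * log n + 1) ((log n + L / 6400) / a) with hβ
  have lnn : 0 ≤ log n := log_natCast_nonneg n
  have βpos : 0 < β := lt_of_lt_of_le (by positivity) (le_max_left _ _)
  have hβa : log n + L / 6400 ≤ β * a := by
    rw [← div_le_iff₀ apos]; exact le_max_right _ _
  set W : Finset (Fin d → ℤ) := Finset.univ.image (fun i => cell l (T i)) with hW
  let w : ι → W := fun i => ⟨cell l (T i), Finset.mem_image_of_mem _ (Finset.mem_univ i)⟩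
  haveI := g.lgauss T
  have hm := g.sep_mean hN σ hσ T hT
  have Kpos : 0 < K := lt_of_lt_of_le (by positivity) hK2
  have key := mx_super (P.map (vec X T)) (g.lzero T) βpos w (fun a b => nbr a.1 b.1)
    (fun v v' h => nbr_symm _ _ h) (3 ^ d) (fun v => nbr_card W v)
    (fun i j => by rw [g.lcv]; exact g.le_one _ dist_nonneg) Kpos.le
    (fun i j h => by
      rw [g.lcv]
      exact (g.mono _ _ (by positivity) (l1.trans (cell_far lpos h))).trans hK1)
    (τ := exp (-(L / 12800))) (exp_pos _) (by rw [exp_lt_one_iff]; linarith)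
    (fun v => by
      refine (g.tau T w v (a := a) βpos).trans ?_
      refine exp_split d hL2 ?_ ?_ ?_
      · have h1 := hκ T l lpos v.1 a (by linarith)
        have e : {ω | ∃ i, w i = v ∧ a < X (T i) ω} = {ω | ∃ i, cell l (T i) = v.1 ∧ a < X (T i) ω} := by
          ext ω; simp only [Set.mem_ofPred_eq, w, Subtype.ext_iff]
        rw [e]
        refine h1.trans ?_
        calc (l : ℝ) ^ d * exp (-(a - κ) ^ 2 / 2) ≤ (2 * (N : ℝ) ^ C) ^ d * exp (-(L / 3200)) := by
              gcongr
              have : (x / 40) ^ 2 ≤ (a - κ) ^ 2 := by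
                apply pow_le_pow_left₀ (by positivity); linarith
              nlinarith
          _ = 2 ^ d * exp (d * C * L - L / 3200) := by
              rw [mul_pow, hNC, ← exp_nat_mul, mul_assoc, ← exp_add]; congr 2; ring
          _ ≤ 2 ^ d * exp (-(L / 6400)) := by
              gcongr
              nlinarith
      · calc P.real {ω | MT X T ω ≤ 2 * a} ≤ P.real {ω | MT X T ω ≤ ∫ ω', MT X T ω' ∂P - x / 10} := by
              refine measureReal_mono (fun ω hω => ?_) (measure_ne_top _ _)
              simp only [Set.mem_ofPred_eq] at hω ⊢
              linarith
          _ ≤ exp (-(x / 10) ^ 2 / 2) := g.lower T (by positivity)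
          _ ≤ _ := by
              apply exp_le_exp.2
              nlinarith
      · calc (n : ℝ) * exp (-(β * a)) = exp (log n - β * a) := by
              rw [sub_eq_add_neg, exp_add, exp_log npos]
          _ ≤ _ := by apply exp_le_exp.2; linarith)
    θ0 (by
      refine le_trans ?_ hθ
      have : log (1 / exp (-(L / 12800))) / 2 = L / 25600 := by
        rw [one_div, ← exp_neg, log_exp]; ring
      rw [this]
      gcongr
      have h3 : ((3 ^ d : ℕ) : ℝ) / (L / 25600) = (1 / L) * (25600 * 3 ^ d) := by
        push_cast; field_simp
      rw [h3]
      have : 1 / L * (25600 * 3 ^ d) ≤ K * (25600 * 3 ^ d) := by gcongr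
      linarith)
    hs (by linarith [le_max_left (θ * log n + 1) ((log n + L / 6400) / a)])
  rw [g.lint_map T (by have := mx_cont (ι := ι); fun_prop), g.lint_map T mx_cont] at key
  exact key

include g in
/-- all sizes, absolute value -/
lemma GF.super_all : ∃ c : ℝ, 0 < c ∧ ∀ N : ℕ, 2 ≤ N → ∀ (σ : Fin N → EuclideanSpace ℝ (Fin d)),
    (∀ i j, i ≠ j → 1 < dist (σ i) (σ j)) → ∀ {ι : Type} [Fintype ι] [Nonempty ι] (T : ι → EuclideanSpace ℝ (Fin d)),
    (∀ k, ∃ i, T i = σ k) → ∀ θ : ℝ,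
    θ = c / √(max (φ ((N : ℝ) ^ (1 / (6400 * (d + 1) : ℝ)))) (1 / log N)) →
    Integrable (fun ω => exp (θ * |MT X T ω - ∫ ω', MT X T ω' ∂P|)) P ∧
    ∫ ω, exp (θ * |MT X T ω - ∫ ω', MT X T ω' ∂P|) ∂P ≤ 384 := by
  obtain ⟨L0, h⟩ := g.super_fin
  set B : ℝ := max (1 + 25600 * 3 ^ d) L0 with hB
  have B1 : 1 + 25600 * 3 ^ d ≤ B := le_max_left _ _
  have B2 : L0 ≤ B := le_max_right _ _
  have Bpos : 0 < B := lt_of_lt_of_le (by positivity) B1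
  refine ⟨1 / √B, by positivity, ?_⟩
  intro N hN σ hσ ι _ _ T hT θ hθ
  set K := max (φ ((N : ℝ) ^ (1 / (6400 * (d + 1) : ℝ)))) (1 / log N) with hK
  have N2 : (2 : ℝ) ≤ N := by exact_mod_cast hN
  have Lpos : 0 < log (N : ℝ) := log_pos (by linarith)
  have K2 : 1 / log N ≤ K := le_max_right _ _
  have Kpos : 0 < K := lt_of_lt_of_le (by positivity) K2
  have θ0 : 0 ≤ θ := by rw [hθ]; positivity
  have θ2 : θ ^ 2 = 1 / (B * K) := by
    rw [hθ, div_pow, div_pow, sq_sqrt Bpos.le, sq_sqrt Kpos.le, one_pow, div_div]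
  have main : ∀ s : ℝ, s ^ 2 = 1 → ∫ ω, exp (s * θ * (MT X T ω - ∫ ω', MT X T ω' ∂P)) ∂P ≤ 192 := by
    intro s hs
    by_cases hc : L0 ≤ log N
    · refine h N hN hc σ hσ T hT K θ s (le_max_left _ _) K2 θ0 ?_ hs
      rw [θ2, one_div, inv_mul_le_iff₀ (by positivity), mul_one, mul_comm K]
      gcongr
    · push Not at hc
      refine (g.MTherbst T _).trans ?_
      have : (s * θ) ^ 2 ≤ 1 := by
        rw [mul_pow, hs, one_mul, θ2, div_le_one (by positivity)]
        have : log N * (1 / log N) ≤ B * K := by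
          apply mul_le_mul (by linarith) K2 (by positivity) Bpos.le
        rwa [mul_one_div_cancel Lpos.ne'] at this
      calc exp ((s * θ) ^ 2 / 2) ≤ exp 1 := exp_le_exp.2 (by linarith)
        _ ≤ 192 := exp_one_lt_d9.le.trans (by norm_num)
  set m := ∫ ω', MT X T ω' ∂P with hm
  have i1 := g.MTexpint T (1 * θ) m
  have i2 := g.MTexpint T (-1 * θ) m
  have hle : ∀ ω, exp (θ * |MT X T ω - m|) ≤ exp (1 * θ * (MT X T ω - m)) + exp (-1 * θ * (MT X T ω - m)) := by
    intro ω
    have p1 := exp_pos (1 * θ * (MT X T ω - m))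
    have p2 := exp_pos (-1 * θ * (MT X T ω - m))
    rcases abs_choice (MT X T ω - m) with h | h
    · rw [h, one_mul] at *; linarith
    · rw [h, show θ * -(MT X T ω - m) = -1 * θ * (MT X T ω - m) by ring]; linarith
  have mm := g.MTmeas T
  have ii : Integrable (fun ω => exp (θ * |MT X T ω - m|)) P := by
    refine (i1.add i2).mono' (by fun_prop) (ae_of_all _ fun ω => ?_)
    rw [norm_of_nonneg (exp_pos _).le]; exact hle ω
  refine ⟨ii, ?_⟩
  have := integral_mono ii (i1.add i2) hle
  rw [integral_add' i1 i2] at this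
  linarith [main 1 (by norm_num), main (-1) (by norm_num)]
end fin


lemma limit_conc {Ω : Type*} [MeasurableSpace Ω] {P : Measure Ω} [IsProbabilityMeasure P] (Y : ℕ → Ω → ℝ) (M : Ω → ℝ)
    (hY : ∀ n, Measurable (Y n)) (hYi : ∀ n, Integrable (Y n) P) (hmono : ∀ ω, Monotone fun n => Y n ω)
    (hlim : ∀ ω, Filter.Tendsto (fun n => Y n ω) Filter.atTop (nhds (M ω))) {κ : ℝ} (hκ : ∀ n, ∫ ω, Y n ω ∂P ≤ κ)
    {θ : ℝ} (θ0 : 0 < θ)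
    (hE : ∀ n, Integrable (fun ω => exp (θ * |Y n ω - ∫ ω', Y n ω' ∂P|)) P ∧
      ∫ ω, exp (θ * |Y n ω - ∫ ω', Y n ω' ∂P|) ∂P ≤ 384) (t : ℝ) :
    P.real {ω | t ≤ |M ω - ∫ ω', M ω' ∂P|} ≤ 6 * exp (-(θ * t / 4)) := by
  set m : ℕ → ℝ := fun n => ∫ ω, Y n ω ∂P with hm
  have mmono : Monotone m := fun i j hij => integral_mono (hYi i) (hYi j) fun ω => hmono ω hij
  have hml := tendsto_atTop_ciSup mmono ⟨κ, by rintro _ ⟨n, rfl⟩; exact hκ n⟩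
  set m0 := ⨆ n, m n with hm0
  have Mm : Measurable M := measurable_of_tendsto_metrizable hY (tendsto_pi_nhds.2 hlim)
  have hl : ∫⁻ ω, ENNReal.ofReal (exp (θ * |M ω - m0|)) ∂P ≤ ENNReal.ofReal 384 := by
    have ht : ∀ ω, Filter.Tendsto (fun n => ENNReal.ofReal (exp (θ * |Y n ω - m n|))) Filter.atTop
        (nhds (ENNReal.ofReal (exp (θ * |M ω - m0|)))) := fun ω =>
      ENNReal.tendsto_ofReal ((continuous_exp.tendsto _).comp (((hlim ω).sub hml).abs.const_mul θ))
    calc ∫⁻ ω, ENNReal.ofReal (exp (θ * |M ω - m0|)) ∂P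
        = ∫⁻ ω, Filter.liminf (fun n => ENNReal.ofReal (exp (θ * |Y n ω - m n|))) Filter.atTop ∂P := by
          refine lintegral_congr fun ω => ((ht ω).liminf_eq).symm
      _ ≤ Filter.liminf (fun n => ∫⁻ ω, ENNReal.ofReal (exp (θ * |Y n ω - m n|)) ∂P) Filter.atTop :=
          lintegral_liminf_le fun n => by have := hY n; fun_prop
      _ ≤ ENNReal.ofReal 384 := by
          refine Filter.liminf_le_of_le (by isBoundedDefault) fun b hb => ?_
          obtain ⟨n, hn⟩ := hb.exists
          refine hn.trans ?_
          rw [← ofReal_integral_eq_lintegral_ofReal (hE n).1 (ae_of_all _ fun ω => (exp_pos _).le)]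
          exact ENNReal.ofReal_le_ofReal (hE n).2
  have iE : Integrable (fun ω => exp (θ * |M ω - m0|)) P := by
    refine ⟨by fun_prop, ?_⟩
    rw [hasFiniteIntegral_iff_ofReal (ae_of_all _ fun ω => (exp_pos _).le)]
    exact hl.trans_lt ENNReal.ofReal_lt_top
  have hE2 : ∫ ω, exp (θ * |M ω - m0|) ∂P ≤ 384 := by
    rw [← ofReal_integral_eq_lintegral_ofReal iE (ae_of_all _ fun ω => (exp_pos _).le)] at hl
    exact (ENNReal.ofReal_le_ofReal_iff (by norm_num)).1 hl
  have iM0 : Integrable (fun ω => M ω - m0) P := by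
    refine (iE.const_mul (1 / θ)).mono' (by fun_prop) (ae_of_all _ fun ω => ?_)
    have := add_one_le_exp (θ * |M ω - m0|)
    rw [Real.norm_eq_abs, one_div, ← div_eq_inv_mul, le_div_iff₀ θ0]
    linarith
  have iM : Integrable M P := by
    have := iM0.add (integrable_const m0)
    refine this.congr (ae_of_all _ fun ω => ?_)
    simp
  have hMm : ∫ ω, M ω ∂P = m0 := by
    have := integral_tendsto_of_tendsto_of_monotone hYi iM (ae_of_all _ hmono) (ae_of_all _ hlim)
    exact tendsto_nhds_unique this hml
  rw [hMm]
  set p := P.real {ω | t ≤ |M ω - m0|} with hp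
  have p1 : p ≤ 1 := measureReal_le_one
  have p0 : 0 ≤ p := measureReal_nonneg
  have mk : exp (θ * t) * p ≤ 384 := by
    refine le_trans ?_ hE2
    have := mul_meas_ge_le_integral_of_nonneg (μ := P) (ae_of_all _ fun ω => (exp_pos (θ * |M ω - m0|)).le) iE (exp (θ * t))
    refine le_trans (le_of_eq ?_) this
    congr 1
    rw [hp]
    congr 1
    ext ω
    simp only [Set.mem_ofPred_eq, exp_le_exp]
    rw [mul_le_mul_iff_right₀ θ0]
  set y := exp (-(θ * t / 4)) with hy
  have ypos : 0 < y := exp_pos _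
  have y4 : exp (θ * t) * y ^ 4 = 1 := by
    rw [hy, ← exp_nat_mul, ← exp_add]; simp; ring_nf
  have p4 : p ≤ 384 * y ^ 4 := by
    have : p = (exp (θ * t) * p) * y ^ 4 := by
      calc p = (exp (θ * t) * y ^ 4) * p := by rw [y4, one_mul]
        _ = _ := by ring
    rw [this]; gcongr
  refine le_of_pow_le_pow_left₀ (n := 4) (by norm_num) (by positivity) ?_
  calc p ^ 4 ≤ p ^ 1 := pow_le_pow_of_le_one p0 p1 (by norm_num)
    _ ≤ 384 * y ^ 4 := by rw [pow_one]; exact p4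
    _ ≤ (6 * y) ^ 4 := by rw [mul_pow]; gcongr; norm_num

lemma exists_sep {d : ℕ} (A : Set (EuclideanSpace ℝ (Fin d))) (k : ℕ) (hk : k ≤ coveringNumber A) :
    ∃ σ : Fin k → EuclideanSpace ℝ (Fin d), (∀ i, σ i ∈ A) ∧ ∀ i j, i ≠ j → 1 < dist (σ i) (σ j) := by
  induction k with
  | zero => exact ⟨Fin.elim0, fun i => i.elim0, fun i => i.elim0⟩
  | succ k ih =>
    obtain ⟨σ, h1, h2⟩ := ih (by omega)
    have h3 := Nat.notMem_of_lt_sInf (show k < coveringNumber A by omega)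
    simp only [Set.mem_ofPred_eq, not_exists] at h3
    obtain ⟨x, hx, hx2⟩ := Set.not_subset.1 (h3 σ)
    simp only [Set.mem_iUnion, Metric.mem_closedBall, not_exists, not_le] at hx2
    refine ⟨Fin.cons x σ, fun i => ?_, fun i j => ?_⟩
    · refine Fin.cases ?_ (fun i => ?_) i
      · simpa using hx
      · simpa using h1 i
    · refine Fin.cases ?_ (fun i => ?_) i <;> refine Fin.cases ?_ (fun j => ?_) j
      · simp
      · intro _; simpa using hx2 j
      · intro _; simpa [dist_comm] using hx2 i
      · intro h; simpa using h2 i j (fun e => h (by rw [e]))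

lemma GF.final {Ω : Type*} [MeasurableSpace Ω] {P : Measure Ω} [IsProbabilityMeasure P] {d : ℕ}
    {X : EuclideanSpace ℝ (Fin d) → Ω → ℝ} {φ : ℝ → ℝ} (g : GF P X φ) :
    ∃ C : ℝ, 0 < C ∧ ∃ c : ℝ, 0 < c ∧
      ∀ A : Set (EuclideanSpace ℝ (Fin d)), Bornology.IsBounded A →
        1 < coveringNumber A → ∀ t : ℝ, 0 ≤ t →
          (P {ω | t ≤ |(⨆ s : A, X s ω) - ∫ ω', (⨆ s : A, X s ω') ∂P|}).toReal ≤
            6 * Real.exp (-c * t /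
              Real.sqrt (max (φ ((coveringNumber A : ℝ) ^ C))
                (1 / Real.log (coveringNumber A)))) := by
  obtain ⟨c, c0, hc⟩ := g.super_all
  refine ⟨1 / (6400 * (d + 1) : ℝ), by positivity, c / 4, by positivity, ?_⟩
  intro A hA hN t ht
  have hNA : coveringNumber A ≤ coveringNumber A := le_rfl
  generalize hNdef : coveringNumber A = N at hN hNA ⊢
  obtain ⟨σ, hσA, hσ⟩ := exists_sep A N (by omega)
  obtain ⟨κ, -, hκ⟩ := g.mean_bdd hA
  set K := max (φ ((N : ℝ) ^ (1 / (6400 * (d + 1) : ℝ)))) (1 / log N) with hK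
  have N2 : (2 : ℝ) ≤ N := by exact_mod_cast hN
  have Lpos : 0 < log (N : ℝ) := log_pos (by linarith)
  have Kpos : 0 < K := lt_of_lt_of_le (by positivity) (le_max_right _ _ : 1 / log N ≤ K)
  have hN0 : Nonempty (Fin N) := ⟨⟨0, by omega⟩⟩
  have hAn : Nonempty A := ⟨⟨σ hN0.some, hσA _⟩⟩
  let D : ℕ → A := TopologicalSpace.denseSeq A
  let T : (n : ℕ) → Fin N ⊕ Fin n → EuclideanSpace ℝ (Fin d) := fun n => Sum.elim σ fun i => (D i : EuclideanSpace ℝ (Fin d))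
  have TA : ∀ n i, T n i ∈ A := fun n i => by
    rcases i with i | i
    · exact hσA i
    · exact (D i).2
  have bT : ∀ n ω, BddAbove (Set.range fun i => X (T n i) ω) := fun n ω => (Set.finite_range _).bddAbove
  have bA : ∀ ω, BddAbove (Set.range fun s : A => X s ω) := fun ω => by
    obtain ⟨b, hb⟩ := g.bdd hA ω
    exact ⟨b, by rintro _ ⟨s, rfl⟩; exact hb s s.2⟩
  have hle : ∀ n ω, MT X (T n) ω ≤ ⨆ s : A, X s ω := fun n ω =>
    ciSup_le fun i => le_ciSup (bA ω) (⟨T n i, TA n i⟩ : A)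
  have hmono : ∀ ω, Monotone fun n => MT X (T n) ω := by
    intro ω n n' hn
    refine ciSup_le fun i => ?_
    rcases i with i | i
    · exact le_ciSup (bT n' ω) (Sum.inl i)
    · exact le_ciSup (bT n' ω) (Sum.inr (Fin.castLE hn i))
  have hlim : ∀ ω, Filter.Tendsto (fun n => MT X (T n) ω) Filter.atTop (nhds (⨆ s : A, X s ω)) := by
    intro ω
    refine tendsto_atTop_isLUB (hmono ω) ⟨by rintro _ ⟨n, rfl⟩; exact hle n ω, fun b hb => ?_⟩
    refine ciSup_le fun s => ?_
    have hcl : IsClosed {s : A | X s ω ≤ b} :=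
      isClosed_le ((g.cont ω).comp continuous_subtype_val) continuous_const
    have : closure (Set.range D) ⊆ {s : A | X s ω ≤ b} := by
      refine hcl.closure_subset_iff.2 ?_
      rintro _ ⟨n, rfl⟩
      have h1 := hb ⟨n + 1, rfl⟩
      exact le_trans (le_ciSup (bT (n + 1) ω) (Sum.inr (Fin.last n))) h1
    exact this (TopologicalSpace.denseRange_denseSeq A s)
  have key := limit_conc (P := P) (fun n => MT X (T n)) (fun ω => ⨆ s : A, X s ω) (fun n => g.MTmeas (T n))
    (fun n => g.MTint (T n)) hmono hlim (fun n => hκ (T n) (TA n)) (θ := c / √K) (by positivity)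
    (fun n => hc N hN σ hσ (T n) (fun k => ⟨Sum.inl k, rfl⟩) _ rfl) t
  refine le_trans key (le_of_eq ?_)
  congr 2
  ring

/-- **Superconcentration for stationary Gaussian Euclidean fields** (Tanguy, Theorem 1.5 /
`GP`). Let `(X_t)_{t ∈ ℝ^d}` be a centered stationary Gaussian field with continuous sample
paths, unit variances and covariance `Cov(X_s, X_t) = φ(|t − s|)` with `φ` non-increasing on
`[0, ∞)` and `φ(1) < 1/2`. Then there are `C = C(φ,d) > 0` and `c = c(φ,d) > 0` such that
for every bounded `A ⊆ ℝ^d` with `N(A) > 1` and all `t ≥ 0`,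
`P(|M_A − E[M_A]| ≥ t) ≤ 6 exp(−c t / √K_{N(A)})`, where `M_A = sup_{s ∈ A} X_s` and
`K_{N(A)} = max(φ(N(A)^C), 1/log N(A))`. -/
theorem stationary_gaussian_field_superconcentration
    {Ω : Type*} [MeasurableSpace Ω] (P : Measure Ω) [IsProbabilityMeasure P]
    (d : ℕ) (X : EuclideanSpace ℝ (Fin d) → Ω → ℝ)
    (hXmeas : ∀ s, Measurable (X s))
    (hXcont : ∀ ω, Continuous fun s => X s ω)
    -- every finite subfamily is jointly centered Gaussian
    (hgauss : ∀ (k : ℕ) (s : Fin k → EuclideanSpace ℝ (Fin d)) (a : Fin k → ℝ),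
      ∃ v : NNReal, P.map (fun ω => ∑ i, a i * X (s i) ω) = gaussianReal 0 v)
    (φ : ℝ → ℝ) (hφ0 : φ 0 = 1)
    -- stationary covariance structure: `Cov(X_s, X_t) = φ(|t − s|)`
    (hcov : ∀ s t, ∫ ω, X s ω * X t ω ∂P = φ (dist s t))
    (hφmono : ∀ x y, 0 ≤ x → x ≤ y → φ y ≤ φ x) (hφ1 : φ 1 < 1 / 2) :
    ∃ C : ℝ, 0 < C ∧ ∃ c : ℝ, 0 < c ∧
      ∀ A : Set (EuclideanSpace ℝ (Fin d)), Bornology.IsBounded A →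
        1 < coveringNumber A → ∀ t : ℝ, 0 ≤ t →
          (P {ω | t ≤ |(⨆ s : A, X s ω) - ∫ ω', (⨆ s : A, X s ω') ∂P|}).toReal ≤
            6 * Real.exp (-c * t /
              Real.sqrt (max (φ ((coveringNumber A : ℝ) ^ C))
                (1 / Real.log (coveringNumber A)))) := by
  exact GF.final ⟨hXmeas, hXcont, hgauss, hφ0, hcov, hφmono, hφ1⟩
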